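/- Let λ = (a^b, c^d) be a fat hook (a Young diagram with b rows of length a followed by d rows of length c, where a ≥ c), and let U be any unique rectification target for ℕ×ℕ that fits in the corner of M_λ. Then the tableau M_λ ∪ U is a unique rectification target for ℕ×ℕ. -/

import Mathlib

open Classical

noncomputable section

/-- A straight shape in a poset: a finite lower order ideal, given as a `Finset`. -/
def StraightShape {L : Type} [PartialOrder L] (lam : Finset L) : Prop :=
  ∀ a ∈ lam, ∀ b : L, b ≤ a → b ∈ lam

/-- The shape (set of boxes) of a partially defined tableau. -/
def shapeOf {L : Type} {V : Type} (T : L → Option V) : Set L := {α | T α ≠ none}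

/-- `lam ⊆ nu` is a pair of straight shapes, defining the skew shape `nu / lam`. -/
def IsSkewPair {L : Type} [PartialOrder L] (lam nu : Finset L) : Prop :=
  StraightShape lam ∧ StraightShape nu ∧ lam ⊆ nu

/-- `T` is defined on a skew shape `nu / lam`. -/
def HasSkewShape {L : Type} [PartialOrder L] (T : L → Option ℤ) : Prop :=
  ∃ lam nu : Finset L, IsSkewPair lam nu ∧ shapeOf T = (nu : Set L) \ (lam : Set L)

/-- `T` is strictly increasing along the partial order. -/
def Increasing {L : Type} [PartialOrder L] (T : L → Option ℤ) : Prop :=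
  ∀ a b : L, a < b → ∀ x y : ℤ, T a = some x → T b = some y → x < y

/-- An increasing tableau of skew shape. -/
def IncreasingSkewTableau {L : Type} [PartialOrder L] (T : L → Option ℤ) : Prop :=
  HasSkewShape T ∧ Increasing T

/-- Two boxes are neighbors if one covers the other. -/
def Neighbor {L : Type} [PartialOrder L] (a b : L) : Prop := a ⋖ b ∨ b ⋖ a

/-- The swap operation `swap_{s,s'}`. -/
def swapVal {L : Type} [PartialOrder L] {V : Type} (s s' : V) (T : L → Option V) :
    L → Option V := fun α =>
  if T α = some s ∧ ∃ β, Neighbor α β ∧ T β = some s' then some s'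
  else if T α = some s' ∧ ∃ β, Neighbor α β ∧ T β = some s then some s
  else T α

/-- Integer values extended with a dot `•`. -/
abbrev ZDot : Type := ℤ ⊕ Unit

def toDotted {L : Type} (T : L → Option ℤ) : L → Option ZDot := fun α => (T α).map Sum.inl

/-- Place a dot in every box of `C`. -/
def addDots {L : Type} (C : Finset L) (T : L → Option ZDot) : L → Option ZDot := fun α =>
  if α ∈ C then some (Sum.inr ()) else T α

/-- Restrict a dotted tableau to its integer-valued boxes. -/
def restrictInt {L : Type} (T : L → Option ZDot) : L → Option ℤ := fun α =>
  (T α).bind (Sum.elim some fun _ => none)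

/-- Apply `swap_{a,•}, swap_{a+1,•}, …, swap_{a+n-1,•}` in this (increasing) order. -/
def swapUp {L : Type} [PartialOrder L] (a : ℤ) : ℕ → (L → Option ZDot) → (L → Option ZDot)
  | 0, T => T
  | n + 1, T => swapVal (Sum.inl (a + n)) (Sum.inr ()) (swapUp a n T)

/-- Apply `swap_{b,•}, swap_{b-1,•}, …, swap_{b-n+1,•}` in this (decreasing) order. -/
def swapDown {L : Type} [PartialOrder L] (b : ℤ) : ℕ → (L → Option ZDot) → (L → Option ZDot)
  | 0, T => T
  | n + 1, T => swapVal (Sum.inl (b - n)) (Sum.inr ()) (swapDown b n T)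

/-- All values of `T` lie in the interval `[a, b]`. -/
def ValuesIn {L : Type} (T : L → Option ℤ) (a b : ℤ) : Prop :=
  ∀ (α : L) (x : ℤ), T α = some x → a ≤ x ∧ x ≤ b

/-- `T'` is obtained from `T` by a single forward jeu de taquin slide `jdt_C`,
starting from a set `C` of maximal boxes of the inner shape. -/
def IsForwardSlide {L : Type} [PartialOrder L] (T T' : L → Option ℤ) : Prop :=
  ∃ (lam nu C : Finset L) (a b : ℤ),
    IsSkewPair lam nu ∧ shapeOf T = (nu : Set L) \ (lam : Set L) ∧ ValuesIn T a b ∧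
    (∀ c ∈ C, c ∈ lam ∧ ∀ d ∈ lam, ¬ c < d) ∧
    T' = restrictInt (swapUp a (b - a + 1).toNat (addDots C (toDotted T)))

/-- `T'` is obtained from `T` by a single reverse jeu de taquin slide,
starting from a set `C` of minimal boxes of the complement of the outer shape. -/
def IsReverseSlide {L : Type} [PartialOrder L] (T T' : L → Option ℤ) : Prop :=
  ∃ (lam nu C : Finset L) (a b : ℤ),
    IsSkewPair lam nu ∧ shapeOf T = (nu : Set L) \ (lam : Set L) ∧ ValuesIn T a b ∧
    (∀ c ∈ C, c ∉ nu ∧ ∀ d : L, d ∉ nu → ¬ d < c) ∧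
    T' = restrictInt (swapDown b (b - a + 1).toNat (addDots C (toDotted T)))

/-- Jeu de taquin equivalence: a finite sequence of forward and reverse slides. -/
def JdtEquiv {L : Type} [PartialOrder L] (T T' : L → Option ℤ) : Prop :=
  Relation.ReflTransGen (fun A B => IsForwardSlide A B ∨ IsReverseSlide A B) T T'

/-- `T` is defined on a straight shape. -/
def HasStraightShape {L : Type} [PartialOrder L] (T : L → Option ℤ) : Prop :=
  ∃ lam : Finset L, StraightShape lam ∧ shapeOf T = (lam : Set L)

/-- `U` is a rectification of `T`: a straight-shape tableau obtained by forward slides. -/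
def RectifiesTo {L : Type} [PartialOrder L] (T U : L → Option ℤ) : Prop :=
  Relation.ReflTransGen IsForwardSlide T U ∧ HasStraightShape U

/-- Unique rectification target. -/
def IsURT {L : Type} [PartialOrder L] (U : L → Option ℤ) : Prop :=
  HasStraightShape U ∧ Increasing U ∧
    ∀ T : L → Option ℤ, IncreasingSkewTableau T → RectifiesTo T U →
      ∀ U' : L → Option ℤ, RectifiesTo T U' → U' = U

/-- The minimal increasing tableau of a shape `θ`: each box `α` receives the maximal
cardinality of a totally ordered subset of `θ` having `α` as its maximal element. -/
def minTab {L : Type} [PartialOrder L] (θ : Finset L) : L → Option ℤ := fun α =>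
  if α ∈ θ then
    some ((sSup {n : ℕ | ∃ s : Finset L, (s : Set L) ⊆ (θ : Set L) ∧
      (∀ a ∈ s, ∀ b ∈ s, a ≤ b ∨ b ≤ a) ∧ α ∈ s ∧ (∀ a ∈ s, a ≤ α) ∧ s.card = n} : ℕ) : ℤ)
  else none

/-- A unique rectification poset. -/
def IsURP (L : Type) [PartialOrder L] : Prop :=
  ∀ lam : Finset L, StraightShape lam → IsURT (minTab lam)

/-- The structure constant `c^ν_{λ,μ}`: the number of increasing tableaux of
shape `ν/λ` that have the minimal increasing tableau `M_μ` as a rectification. -/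
def ccoef {L : Type} [PartialOrder L] (lam mu nu : Finset L) : ℕ :=
  Set.ncard {T : L → Option ℤ | Increasing T ∧ shapeOf T = (nu : Set L) \ (lam : Set L) ∧
    RectifiesTo T (minTab mu)}

/-- The fat hook `(a^b, c^d)`: `b` rows of length `a` followed by `d` rows of
length `c` (where `a ≥ c`). -/
def fatHook (a b c d : ℕ) : Finset (ℕ × ℕ) :=
  ((Finset.range (b + d)) ×ˢ (Finset.range a)).filter fun p => p.1 < b ∨ p.2 < c

/-- The tableau `M_λ ∪ U`: attach `U` to the corner of the minimal increasing
tableau of the fat hook `λ = (a^b, c^d)`. -/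
def fatHookGlue (a b c d : ℕ) (U : ℕ × ℕ → Option ℤ) : ℕ × ℕ → Option ℤ := fun p =>
  if b ≤ p.1 ∧ c ≤ p.2 then U (p.1 - b, p.2 - c) else minTab (fatHook a b c d) p

/-- The smaller of the two values to the right of and below the box `(i, j)`. -/
def nextVal (T : ℕ × ℕ → Option ℤ) (i j : ℕ) : Option ℤ :=
  match T (i, j + 1), T (i + 1, j) with
  | none, y => y
  | some x, none => some x
  | some x, some y => some (min x y)

lemma nextVal_eq_none {T : ℕ × ℕ → Option ℤ} {i j : ℕ} :
    nextVal T i j = none ↔ T (i, j + 1) = none ∧ T (i + 1, j) = none := by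
  unfold nextVal
  split <;> simp_all

lemma nextVal_eq_some {T : ℕ × ℕ → Option ℤ} {i j : ℕ} {v : ℤ} :
    nextVal T i j = some v ↔
      (T (i, j + 1) = some v ∨ T (i + 1, j) = some v) ∧
      (∀ w, T (i, j + 1) = some w → v ≤ w) ∧ ∀ w, T (i + 1, j) = some w → v ≤ w := by
  unfold nextVal
  split
  · rename_i h
    simp only [h]
    grind
  · rename_i h h'
    simp only [h, h']
    grind
  · rename_i h h'
    simp only [h, h', Option.some.injEq]
    constructor
    · rintro rfl
      grind
    · rintro ⟨h1, h2, h3⟩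
      have := h2 _ rfl
      have := h3 _ rfl
      grind

/-- The boxes whose content changes during the slide of `T` from `C`. -/
inductive Affected (T : ℕ × ℕ → Option ℤ) (C : Finset (ℕ × ℕ)) : ℕ → ℕ → Prop
  | dot {i j : ℕ} : (i, j) ∈ C → Affected T C i j
  | right {i j : ℕ} {v : ℤ} : Affected T C i j → T (i, j + 1) = some v →
      nextVal T i j = some v → Affected T C i (j + 1)
  | down {i j : ℕ} {v : ℤ} : Affected T C i j → T (i + 1, j) = some v →
      nextVal T i j = some v → Affected T C (i + 1) j

/-- The result of the forward slide of `T` from `C`, described statically. -/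
def slide (T : ℕ × ℕ → Option ℤ) (C : Finset (ℕ × ℕ)) : ℕ × ℕ → Option ℤ := fun p =>
  if Affected T C p.1 p.2 then nextVal T p.1 p.2 else T p

/-- `C` is a set of maximal boxes of the inner shape of the tableau `T` of shape `nu / lam`. -/
structure SlideSite (lam nu C : Finset (ℕ × ℕ)) (T : ℕ × ℕ → Option ℤ) : Prop where
  pair : IsSkewPair lam nu
  shape : ∀ p, T p ≠ none ↔ p ∈ nu ∧ p ∉ lam
  mem : ∀ c ∈ C, c ∈ lam
  max : ∀ c ∈ C, ∀ d ∈ lam, ¬ c < d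

lemma neighbor_iff {p q : ℕ × ℕ} : Neighbor p q ↔
    q = (p.1, p.2 + 1) ∨ q = (p.1 + 1, p.2) ∨ p = (q.1, q.2 + 1) ∨ p = (q.1 + 1, q.2) := by
  obtain ⟨i, j⟩ := p
  obtain ⟨k, l⟩ := q
  simp only [Neighbor, Prod.mk_covBy_mk_iff, Nat.covBy_iff_add_one_eq, Prod.mk.injEq]
  omega

lemma Affected.mem_or {T : ℕ × ℕ → Option ℤ} {C : Finset (ℕ × ℕ)} {i j : ℕ}
    (h : Affected T C i j) : (i, j) ∈ C ∨ ∃ v, T (i, j) = some v := by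
  cases h with
  | dot h => exact .inl h
  | right _ h _ => exact .inr ⟨_, h⟩
  | down _ h _ => exact .inr ⟨_, h⟩

namespace Increasing

variable {T : ℕ × ℕ → Option ℤ}

lemma row (hT : Increasing T) {i j j' : ℕ} {x y : ℤ} (h : j < j') (hx : T (i, j) = some x)
    (hy : T (i, j') = some y) : x < y :=
  hT _ _ (Prod.mk_lt_mk.2 (.inr ⟨le_rfl, h⟩)) _ _ hx hy

lemma col (hT : Increasing T) {i i' j : ℕ} {x y : ℤ} (h : i < i') (hx : T (i, j) = some x)
    (hy : T (i', j) = some y) : x < y :=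
  hT _ _ (Prod.mk_lt_mk.2 (.inl ⟨h, le_rfl⟩)) _ _ hx hy

end Increasing

namespace SlideSite

variable {lam nu C : Finset (ℕ × ℕ)} {T : ℕ × ℕ → Option ℤ}

lemma none_of_le_lam (hs : SlideSite lam nu C T) {p q : ℕ × ℕ} (hq : q ∈ lam) (h : p ≤ q) :
    T p = none := by
  by_contra hp
  exact ((hs.shape p).1 hp).2 (hs.pair.1 q hq p h)

lemma none_of_le (hs : SlideSite lam nu C T) {p c : ℕ × ℕ} (hc : c ∈ C) (h : p ≤ c) :
    T p = none :=
  hs.none_of_le_lam (hs.mem c hc) h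

end SlideSite

/-- The dotted tableau in the middle of a slide, after all values less than `s` have moved. -/
def slideState (T : ℕ × ℕ → Option ℤ) (C : Finset (ℕ × ℕ)) (s : ℤ) : ℕ × ℕ → Option ZDot :=
  fun p =>
  if Affected T C p.1 p.2 then
    if ∃ v, T p = some v ∧ s ≤ v then (T p).map Sum.inl
    else if ∃ w, nextVal T p.1 p.2 = some w ∧ w < s then (nextVal T p.1 p.2).map Sum.inl
    else some (Sum.inr ())
  else (T p).map Sum.inl

section Dynamics

variable {lam nu C : Finset (ℕ × ℕ)} {T : ℕ × ℕ → Option ℤ}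

lemma slideState_eq_inl {s : ℤ} {p : ℕ × ℕ} :
    slideState T C s p = some (Sum.inl s) ↔ T p = some s := by
  unfold slideState
  split_ifs with h1 h2 h3
  · simp
  · obtain ⟨w, hw, hlt⟩ := h3
    simp only [hw, Option.map_some, Option.some.injEq, Sum.inl.injEq]
    constructor
    · intro h; omega
    · intro h; exact absurd ⟨s, h, le_rfl⟩ h2
  · simp only [Option.some.injEq, reduceCtorEq, false_iff]
    exact fun h => h2 ⟨s, h, le_rfl⟩
  · simp

lemma slideState_eq_dot {s : ℤ} {p : ℕ × ℕ} :
    slideState T C s p = some (Sum.inr ()) ↔ Affected T C p.1 p.2 ∧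
      (∀ v, T p = some v → v < s) ∧ ∀ w, nextVal T p.1 p.2 = some w → s ≤ w := by
  unfold slideState
  split_ifs with h1 h2 h3
  · obtain ⟨v, hv, hle⟩ := h2
    simp only [hv]
    simp
    intros; omega
  · obtain ⟨w, hw, hlt⟩ := h3
    simp only [hw]
    simp
    intros; omega
  · simp only [h1, true_and, true_iff]
    push Not at h2 h3
    exact ⟨h2, h3⟩
  · simp [h1]

lemma slideState_step_of_eq (hT : Increasing T) {s : ℤ} {p : ℕ × ℕ} (hp : T p = some s) :
    slideState T C (s + 1) p =
      if Affected T C p.1 p.2 then some (Sum.inr ()) else some (Sum.inl s) := by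
  split_ifs with h
  · rw [slideState_eq_dot]
    refine ⟨h, fun v hv => by rw [hp] at hv; cases hv; omega, fun w hw => ?_⟩
    obtain ⟨i, j⟩ := p
    rw [nextVal_eq_some] at hw
    rcases hw.1 with h' | h'
    · have := hT.row (by omega) hp h'; omega
    · have := hT.col (by omega) hp h'; omega
  · simp [slideState, h, hp]

lemma slideState_step_of_dot {s : ℤ} {p : ℕ × ℕ}
    (hp : slideState T C s p = some (Sum.inr ())) :
    slideState T C (s + 1) p =
      if nextVal T p.1 p.2 = some s then some (Sum.inl s) else some (Sum.inr ()) := by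
  rw [slideState_eq_dot] at hp
  obtain ⟨h1, h2, h3⟩ := hp
  have h4 : ¬ ∃ v, T p = some v ∧ s + 1 ≤ v := by
    rintro ⟨v, hv, hle⟩
    have := h2 v hv
    omega
  unfold slideState
  rw [if_pos h1, if_neg h4]
  by_cases h : nextVal T p.1 p.2 = some s
  · simp [h]
  · rw [if_neg h, if_neg]
    rintro ⟨w, hw, hlt⟩
    have := h3 w hw
    have : w = s := by omega
    exact h (this ▸ hw)

lemma slideState_step_of_ne {s : ℤ} {p : ℕ × ℕ} (hne : T p ≠ some s)
    (hp : slideState T C s p ≠ some (Sum.inr ())) :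
    slideState T C (s + 1) p = slideState T C s p := by
  rw [Ne, slideState_eq_dot] at hp
  unfold slideState
  by_cases h1 : Affected T C p.1 p.2
  · simp only [h1, if_true]
    simp only [h1, true_and] at hp
    by_cases h2 : ∃ v, T p = some v ∧ s ≤ v
    · rw [if_pos h2, if_pos]
      obtain ⟨v, hv, hle⟩ := h2
      refine ⟨v, hv, ?_⟩
      have : v ≠ s := by rintro rfl; exact hne hv
      omega
    · have h2' : ¬ ∃ v, T p = some v ∧ s + 1 ≤ v :=
        fun ⟨v, hv, hle⟩ => h2 ⟨v, hv, by omega⟩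
      push Not at h2
      have h3 : ∃ w, nextVal T p.1 p.2 = some w ∧ w < s := by
        by_contra h3
        push Not at h3
        exact hp ⟨h2, h3⟩
      have h2'' : ¬ ∃ v, T p = some v ∧ s ≤ v := by push Not; exact h2
      have h3' : ∃ w, nextVal T p.1 p.2 = some w ∧ w < s + 1 := by
        obtain ⟨w, hw, hlt⟩ := h3
        exact ⟨w, hw, by omega⟩
      rw [if_neg h2', if_neg h2'', if_pos h3, if_pos h3']
  · simp [h1]

lemma neighbor_dot_iff (hs : SlideSite lam nu C T) (hT : Increasing T) {s : ℤ} {p : ℕ × ℕ}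
    (hp : T p = some s) :
    (∃ q, Neighbor p q ∧ slideState T C s q = some (Sum.inr ())) ↔ Affected T C p.1 p.2 := by
  constructor
  · rintro ⟨⟨k, l⟩, hq, hd⟩
    obtain ⟨i, j⟩ := p
    rw [slideState_eq_dot] at hd
    obtain ⟨h1, h2, h3⟩ := hd
    rw [neighbor_iff] at hq
    simp only [Prod.mk.injEq] at hq h1 h3 ⊢
    have below : (i, j) ≤ (k, l) → i + j < k + l → False := by
      intro hle hlt
      rcases h1.mem_or with h | ⟨v, hv⟩
      · rw [hs.none_of_le h hle] at hp; cases hp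
      · have := h2 v hv
        have := hT _ _ (lt_of_le_of_ne hle (by rintro ⟨⟩; omega)) _ _ hp hv
        omega
    rcases hq with ⟨rfl, rfl⟩ | ⟨rfl, rfl⟩ | ⟨rfl, rfl⟩ | ⟨rfl, rfl⟩
    · exact (below (by simp [Prod.le_def]) (by omega)).elim
    · exact (below (by simp [Prod.le_def]) (by omega)).elim
    · refine .right h1 hp (nextVal_eq_some.2 ⟨.inl hp, fun w hw => ?_, fun w hw => ?_⟩)
      · rw [hp] at hw; cases hw; rfl
      · rcases hn : nextVal T i l with _ | u
        · rw [nextVal_eq_none] at hn; simp [hn.2] at hw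
        · exact (h3 u hn).trans ((nextVal_eq_some.1 hn).2.2 w hw)
    · refine .down h1 hp (nextVal_eq_some.2 ⟨.inr hp, fun w hw => ?_, fun w hw => ?_⟩)
      · rcases hn : nextVal T k j with _ | u
        · rw [nextVal_eq_none] at hn; simp [hn.1] at hw
        · exact (h3 u hn).trans ((nextVal_eq_some.1 hn).2.1 w hw)
      · rw [hp] at hw; cases hw; rfl
  · intro h
    obtain ⟨i, j⟩ := p
    cases h with
    | dot h => rw [hs.none_of_le h le_rfl] at hp; cases hp
    | @right _ j v h1 h2 h3 =>
      obtain rfl : v = s := by simpa [h2] using hp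
      refine ⟨(i, j), by simp [neighbor_iff], slideState_eq_dot.2 ⟨h1, fun w hw => ?_, ?_⟩⟩
      · exact hT.row (Nat.lt_succ_self _) hw hp
      · intro w hw; rw [h3] at hw; cases hw; rfl
    | @down i _ v h1 h2 h3 =>
      obtain rfl : v = s := by simpa [h2] using hp
      refine ⟨(i, j), by simp [neighbor_iff], slideState_eq_dot.2 ⟨h1, fun w hw => ?_, ?_⟩⟩
      · exact hT.col (Nat.lt_succ_self _) hw hp
      · intro w hw; rw [h3] at hw; cases hw; rfl

lemma neighbor_val_iff (hs : SlideSite lam nu C T) (hT : Increasing T) {s : ℤ} {p : ℕ × ℕ}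
    (hp : slideState T C s p = some (Sum.inr ())) :
    (∃ q, Neighbor p q ∧ T q = some s) ↔ nextVal T p.1 p.2 = some s := by
  rw [slideState_eq_dot] at hp
  obtain ⟨h1, h2, h3⟩ := hp
  obtain ⟨i, j⟩ := p
  constructor
  · rintro ⟨⟨k, l⟩, hq, hd⟩
    rw [neighbor_iff] at hq
    simp only [Prod.mk.injEq] at hq h1 h3 ⊢
    have above : (k, l) ≤ (i, j) → k + l < i + j → False := by
      intro hle hlt
      rcases h1.mem_or with h | ⟨v, hv⟩
      · rw [hs.none_of_le h hle] at hd; cases hd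
      · have := h2 v hv
        have := hT _ _ (lt_of_le_of_ne hle (by rintro ⟨⟩; omega)) _ _ hd hv
        omega
    have hn : ∀ w, nextVal T i j = some w → w ≤ s → nextVal T i j = some s := by
      intro w hw hle
      have := h3 w hw
      have : w = s := by omega
      exact this ▸ hw
    rcases hq with ⟨rfl, rfl⟩ | ⟨rfl, rfl⟩ | ⟨rfl, rfl⟩ | ⟨rfl, rfl⟩
    · rcases hw : nextVal T k j with _ | w
      · rw [nextVal_eq_none] at hw; simp [hw.1] at hd
      · rw [← hw]; exact hn w hw ((nextVal_eq_some.1 hw).2.1 s hd)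
    · rcases hw : nextVal T i l with _ | w
      · rw [nextVal_eq_none] at hw; simp [hw.2] at hd
      · rw [← hw]; exact hn w hw ((nextVal_eq_some.1 hw).2.2 s hd)
    · exact (above (by simp [Prod.le_def]) (by omega)).elim
    · exact (above (by simp [Prod.le_def]) (by omega)).elim
  · intro h
    rcases (nextVal_eq_some.1 h).1 with h' | h'
    · exact ⟨(i, j + 1), by simp [neighbor_iff], h'⟩
    · exact ⟨(i + 1, j), by simp [neighbor_iff], h'⟩

lemma swapVal_slideState (hs : SlideSite lam nu C T) (hT : Increasing T) (s : ℤ) :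
    swapVal (Sum.inl s) (Sum.inr ()) (slideState T C s) = slideState T C (s + 1) := by
  funext p
  unfold swapVal
  simp only [slideState_eq_inl]
  by_cases h1 : T p = some s
  · rw [slideState_step_of_eq hT h1, ← neighbor_dot_iff hs hT h1]
    have h2 : slideState T C s p = some (Sum.inl s) := slideState_eq_inl.2 h1
    simp only [h1, true_and, h2]
    simp
  · by_cases h2 : slideState T C s p = some (Sum.inr ())
    · rw [slideState_step_of_dot h2]
      simp [h1, h2, neighbor_val_iff hs hT h2]
    · rw [slideState_step_of_ne h1 h2]
      simp [h1, h2]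

lemma swapUp_eq_slideState (hs : SlideSite lam nu C T) (hT : Increasing T) {a b : ℤ}
    (hv : ValuesIn T a b) (n : ℕ) :
    swapUp a n (addDots C (toDotted T)) = slideState T C (a + n) := by
  induction n with
  | zero =>
    funext p
    simp only [swapUp, addDots, toDotted, Nat.cast_zero, add_zero]
    split_ifs with h
    · symm
      rw [slideState_eq_dot]
      refine ⟨.dot h, fun v h' => ?_, fun w hw => ?_⟩
      · rw [hs.none_of_le h le_rfl] at h'; cases h'
      · rcases (nextVal_eq_some.1 hw).1 with h' | h' <;> exact (hv _ _ h').1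
    · unfold slideState
      by_cases h1 : Affected T C p.1 p.2
      · rcases h1.mem_or with h' | ⟨v, hp⟩
        · exact absurd h' h
        · rw [if_pos h1, if_pos ⟨v, hp, (hv _ _ hp).1⟩]
      · rw [if_neg h1]
  | succ n ih =>
    rw [swapUp, ih, swapVal_slideState hs hT]
    congr 1
    push_cast
    ring

lemma restrictInt_swapUp (hs : SlideSite lam nu C T) (hT : Increasing T) {a b : ℤ}
    (hv : ValuesIn T a b) :
    restrictInt (swapUp a (b - a + 1).toNat (addDots C (toDotted T))) = slide T C := by
  rw [swapUp_eq_slideState hs hT hv]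
  have hlt : ∀ p v, T p = some v → v < a + (b - a + 1).toNat := by
    intro p v h
    have := hv p v h
    omega
  funext p
  unfold restrictInt slideState slide
  by_cases h1 : Affected T C p.1 p.2
  · have h2 : ¬ ∃ v, T p = some v ∧ a + ((b - a + 1).toNat : ℤ) ≤ v := by
      rintro ⟨v, h, h'⟩
      have := hlt p v h
      omega
    simp only [if_pos h1, if_neg h2]
    rcases hn : nextVal T p.1 p.2 with _ | w
    · simp
    · have : w < a + (b - a + 1).toNat := by
        rcases (nextVal_eq_some.1 hn).1 with h' | h' <;> exact hlt _ _ h'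
      rw [if_pos ⟨w, rfl, this⟩]
      simp
  · simp only [if_neg h1]
    rcases T p with _ | v <;> simp

end Dynamics

lemma IsForwardSlide.exists_site {T T' : ℕ × ℕ → Option ℤ} (hT : Increasing T)
    (h : IsForwardSlide T T') :
    ∃ lam nu C : Finset (ℕ × ℕ), SlideSite lam nu C T ∧ T' = slide T C := by
  obtain ⟨lam, nu, C, a, b, h1, h2, h3, h4, rfl⟩ := h
  have hs : SlideSite lam nu C T :=
    ⟨h1, fun p => by
      have := Set.ext_iff.1 h2 p
      simpa [shapeOf] using this, fun c hc => (h4 c hc).1, fun c hc => (h4 c hc).2⟩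
  exact ⟨lam, nu, C, hs, restrictInt_swapUp hs hT h3⟩

lemma SlideSite.exists_valuesIn {lam nu C : Finset (ℕ × ℕ)} {T : ℕ × ℕ → Option ℤ}
    (hs : SlideSite lam nu C T) : ∃ a b : ℤ, ValuesIn T a b := by
  have hfin : (((fun p => (T p).getD 0) '' (nu : Set (ℕ × ℕ)))).Finite :=
    nu.finite_toSet.image _
  obtain ⟨a, ha⟩ := hfin.bddBelow
  obtain ⟨b, hb⟩ := hfin.bddAbove
  refine ⟨a, b, fun p x hp => ?_⟩
  have hmem : x ∈ (fun p => (T p).getD 0) '' (nu : Set (ℕ × ℕ)) :=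
    ⟨p, by simpa using ((hs.shape p).1 (by simp [hp])).1, by simp [hp]⟩
  exact ⟨ha hmem, hb hmem⟩

lemma SlideSite.isForwardSlide {lam nu C : Finset (ℕ × ℕ)} {T : ℕ × ℕ → Option ℤ}
    (hs : SlideSite lam nu C T) (hT : Increasing T) : IsForwardSlide T (slide T C) := by
  obtain ⟨a, b, hv⟩ := hs.exists_valuesIn
  refine ⟨lam, nu, C, a, b, hs.pair, ?_, hv, fun c hc => ⟨hs.mem c hc, hs.max c hc⟩,
    (restrictInt_swapUp hs hT hv).symm⟩
  ext p
  simpa [shapeOf] using hs.shape p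

lemma increasing_of_local {T : ℕ × ℕ → Option ℤ}
    (hc : ∀ p q r, p ≤ r → r ≤ q → T p ≠ none → T q ≠ none → T r ≠ none)
    (hr : ∀ i j x y, T (i, j) = some x → T (i, j + 1) = some y → x < y)
    (hd : ∀ i j x y, T (i, j) = some x → T (i + 1, j) = some y → x < y) : Increasing T := by
  have key : ∀ n : ℕ, ∀ p q : ℕ × ℕ, q.1 - p.1 + (q.2 - p.2) = n → p < q →
      ∀ x y, T p = some x → T q = some y → x < y := by
    intro n
    induction n with
    | zero =>
      rintro ⟨i, j⟩ ⟨k, l⟩ hn hlt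
      simp only [Prod.mk_lt_mk] at hlt hn
      omega
    | succ n ih =>
      rintro ⟨i, j⟩ ⟨k, l⟩ hn hlt x y hx hy
      simp only [Prod.mk_lt_mk] at hlt hn
      by_cases h : j < l
      · have h1 : (i, j) ≤ (i, j + 1) := by simp [Prod.le_def]
        have h2 : (i, j + 1) ≤ (k, l) := by simp [Prod.le_def]; omega
        obtain ⟨z, hz⟩ := Option.ne_none_iff_exists'.1
          (hc (i, j) (k, l) (i, j + 1) h1 h2 (by simp [hx]) (by simp [hy]))
        have h3 := hr _ _ _ _ hx hz
        by_cases he : (i, j + 1) = (k, l)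
        · rw [he, hy] at hz; cases hz; exact h3
        · exact h3.trans (ih _ _ (by simp only; omega) (lt_of_le_of_ne h2 he) _ _ hz hy)
      · have h1 : (i, j) ≤ (i + 1, j) := by simp [Prod.le_def]
        have h2 : (i + 1, j) ≤ (k, l) := by simp [Prod.le_def]; omega
        obtain ⟨z, hz⟩ := Option.ne_none_iff_exists'.1
          (hc (i, j) (k, l) (i + 1, j) h1 h2 (by simp [hx]) (by simp [hy]))
        have h3 := hd _ _ _ _ hx hz
        by_cases he : (i + 1, j) = (k, l)
        · rw [he, hy] at hz; cases hz; exact h3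
        · exact h3.trans (ih _ _ (by simp only; omega) (lt_of_le_of_ne h2 he) _ _ hz hy)
  exact fun p q h x y hx hy => key _ p q rfl h x y hx hy

lemma slide_of_affected {T : ℕ × ℕ → Option ℤ} {C : Finset (ℕ × ℕ)} {i j : ℕ}
    (h : Affected T C i j) : slide T C (i, j) = nextVal T i j := if_pos h

lemma slide_of_not_affected {T : ℕ × ℕ → Option ℤ} {C : Finset (ℕ × ℕ)} {i j : ℕ}
    (h : ¬ Affected T C i j) : slide T C (i, j) = T (i, j) := if_neg h

namespace SlideSite

variable {lam nu C : Finset (ℕ × ℕ)} {T : ℕ × ℕ → Option ℤ}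

lemma mem_or_of_slide_ne_none {p : ℕ × ℕ} (h : slide T C p ≠ none) : p ∈ C ∨ T p ≠ none := by
  unfold slide at h
  split_ifs at h with h1
  · rcases h1.mem_or with h2 | ⟨v, h2⟩
    · exact .inl h2
    · exact .inr (by rw [h2]; simp)
  · exact .inr h

lemma ne_none_of_between (hs : SlideSite lam nu C T) {p q r : ℕ × ℕ} (hp : p ∈ C ∨ T p ≠ none)
    (hpq : p < q) (hqr : q ≤ r) (hr : T r ≠ none) : T q ≠ none := by
  rw [hs.shape] at hr ⊢
  refine ⟨hs.pair.2.1 r hr.1 q hqr, fun hq => ?_⟩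
  rcases hp with hp | hp
  · exact hs.max p hp q hq hpq
  · exact ((hs.shape p).1 hp).2 (hs.pair.1 q hq p hpq.le)

lemma slide_ne_none (hs : SlideSite lam nu C T) {q r : ℕ × ℕ} (hq : q ∈ C ∨ T q ≠ none)
    (hqr : q < r) (hr : T r ≠ none) : slide T C q ≠ none := by
  obtain ⟨i, j⟩ := q
  obtain ⟨k, l⟩ := r
  by_cases ha : Affected T C i j
  · rw [slide_of_affected ha, Ne, nextVal_eq_none]
    rw [Prod.mk_lt_mk] at hqr
    rintro ⟨h1, h2⟩
    by_cases h : j < l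
    · exact hs.ne_none_of_between hq (q := (i, j + 1)) (by simp [Prod.mk_lt_mk])
        (by simp [Prod.le_def]; omega) hr h1
    · exact hs.ne_none_of_between hq (q := (i + 1, j)) (by simp [Prod.mk_lt_mk])
        (by simp [Prod.le_def]; omega) hr h2
  · rw [slide_of_not_affected ha]
    rcases hq with hq | hq
    · exact absurd (.dot hq) ha
    · exact hq

lemma slide_le_right (hT : Increasing T) {i j : ℕ} {x y : ℤ} (hx : slide T C (i, j) = some x)
    (hy : T (i, j + 1) = some y) : x ≤ y := by
  by_cases ha : Affected T C i j
  · rw [slide_of_affected ha, nextVal_eq_some] at hx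
    exact hx.2.1 _ hy
  · rw [slide_of_not_affected ha] at hx
    exact (hT.row (Nat.lt_succ_self _) hx hy).le

lemma slide_le_down (hT : Increasing T) {i j : ℕ} {x y : ℤ} (hx : slide T C (i, j) = some x)
    (hy : T (i + 1, j) = some y) : x ≤ y := by
  by_cases ha : Affected T C i j
  · rw [slide_of_affected ha, nextVal_eq_some] at hx
    exact hx.2.2 _ hy
  · rw [slide_of_not_affected ha] at hx
    exact (hT.col (Nat.lt_succ_self _) hx hy).le

lemma le_nextVal_lt (hT : Increasing T) {i j : ℕ} {x y : ℤ} (hx : T (i, j) = some x)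
    (hy : nextVal T i j = some y) : x < y := by
  rcases (nextVal_eq_some.1 hy).1 with h | h
  · exact hT.row (Nat.lt_succ_self _) hx h
  · exact hT.col (Nat.lt_succ_self _) hx h

lemma not_mem_of_slide_lt (hs : SlideSite lam nu C T) {p q : ℕ × ℕ}
    (hp : slide T C p ≠ none) (h : p < q) : q ∉ C := by
  intro hq
  rcases mem_or_of_slide_ne_none hp with h' | h'
  · exact hs.max p h' q (hs.mem q hq) h
  · exact h' (hs.none_of_le hq h.le)

lemma slide_row (hs : SlideSite lam nu C T) (hT : Increasing T) {i j : ℕ} {x y : ℤ}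
    (hx : slide T C (i, j) = some x) (hy : slide T C (i, j + 1) = some y) : x < y := by
  have hnC : (i, j + 1) ∉ C :=
    hs.not_mem_of_slide_lt (p := (i, j)) (by simp [hx]) (by simp [Prod.mk_lt_mk])
  by_cases ha : Affected T C i (j + 1)
  · rw [slide_of_affected ha] at hy
    obtain ⟨z, hz⟩ := ha.mem_or.resolve_left hnC
    exact (slide_le_right hT hx hz).trans_lt (le_nextVal_lt hT hz hy)
  · rw [slide_of_not_affected ha] at hy
    refine lt_of_le_of_ne (slide_le_right hT hx hy) ?_
    rintro rfl
    by_cases ha' : Affected T C i j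
    · rw [slide_of_affected ha'] at hx
      exact ha (.right ha' hy hx)
    · rw [slide_of_not_affected ha'] at hx
      exact lt_irrefl _ (hT.row (Nat.lt_succ_self _) hx hy)

lemma slide_col (hs : SlideSite lam nu C T) (hT : Increasing T) {i j : ℕ} {x y : ℤ}
    (hx : slide T C (i, j) = some x) (hy : slide T C (i + 1, j) = some y) : x < y := by
  have hnC : (i + 1, j) ∉ C :=
    hs.not_mem_of_slide_lt (p := (i, j)) (by simp [hx]) (by simp [Prod.mk_lt_mk])
  by_cases ha : Affected T C (i + 1) j
  · rw [slide_of_affected ha] at hy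
    obtain ⟨z, hz⟩ := ha.mem_or.resolve_left hnC
    exact (slide_le_down hT hx hz).trans_lt (le_nextVal_lt hT hz hy)
  · rw [slide_of_not_affected ha] at hy
    refine lt_of_le_of_ne (slide_le_down hT hx hy) ?_
    rintro rfl
    by_cases ha' : Affected T C i j
    · rw [slide_of_affected ha'] at hx
      exact ha (.down ha' hy hx)
    · rw [slide_of_not_affected ha'] at hx
      exact lt_irrefl _ (hT.col (Nat.lt_succ_self _) hx hy)

lemma ne_none_of_slide_lt (hs : SlideSite lam nu C T) {p q : ℕ × ℕ}
    (hp : slide T C p ≠ none) (h : p < q) (hq : slide T C q ≠ none) : T q ≠ none :=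
  (mem_or_of_slide_ne_none hq).resolve_left (hs.not_mem_of_slide_lt hp h)

lemma slide_increasing (hs : SlideSite lam nu C T) (hT : Increasing T) :
    Increasing (slide T C) := by
  refine increasing_of_local (fun p q r hpr hrq hp hq => ?_)
    (fun i j x y => hs.slide_row hT) (fun i j x y => hs.slide_col hT)
  rcases hpr.eq_or_lt with rfl | hpr
  · exact hp
  rcases hrq.eq_or_lt with rfl | hrq
  · exact hq
  have hTq := hs.ne_none_of_slide_lt hp (hpr.trans hrq) hq
  have hTr := hs.ne_none_of_between (mem_or_of_slide_ne_none hp) hpr hrq.le hTq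
  exact hs.slide_ne_none (.inr hTr) hrq hTq

end SlideSite

lemma IsForwardSlide.increasing {T T' : ℕ × ℕ → Option ℤ} (h : IsForwardSlide T T')
    (hT : Increasing T) : Increasing T' := by
  obtain ⟨lam, nu, C, hs, rfl⟩ := h.exists_site hT
  exact hs.slide_increasing hT

/-- All boxes of `T` lie in the first `R` rows and the first `K` columns. -/
def BoundedBy (T : ℕ × ℕ → Option ℤ) (R K : ℕ) : Prop :=
  ∀ p, T p ≠ none → p.1 < R ∧ p.2 < K

lemma exists_boundedBy_of_subset {T : ℕ × ℕ → Option ℤ} {nu : Finset (ℕ × ℕ)}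
    (h : ∀ p, T p ≠ none → p ∈ nu) : ∃ R K, BoundedBy T R K :=
  ⟨nu.sup Prod.fst + 1, nu.sup Prod.snd + 1, fun p hp =>
    ⟨Nat.lt_succ_of_le (Finset.le_sup (f := Prod.fst) (h p hp)),
      Nat.lt_succ_of_le (Finset.le_sup (f := Prod.snd) (h p hp))⟩⟩

lemma BoundedBy.slide {C : Finset (ℕ × ℕ)} {T : ℕ × ℕ → Option ℤ}
    {R K : ℕ} (h : BoundedBy T R K) : BoundedBy (slide T C) R K := by
  rintro ⟨i, j⟩ hp
  by_cases ha : Affected T C i j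
  · rw [slide_of_affected ha, Ne, nextVal_eq_none, not_and_or] at hp
    rcases hp with hp | hp
    · have := h _ hp
      simp only at this ⊢
      omega
    · have := h _ hp
      simp only at this ⊢
      omega
  · rw [slide_of_not_affected ha] at hp
    exact h _ hp

/-- A map from letters to a monoid that respects the K-Knuth relations. -/
structure KKnuth {M : Type} [Monoid M] (f : ℤ → M) : Prop where
  idem : ∀ x, f x * f x = f x
  braid : ∀ x y, f x * (f y * f x) = f y * (f x * f y)
  left : ∀ x y z, x < y → y < z → f x * (f z * f y) = f z * (f x * f y)
  right : ∀ x y z, x < y → y < z → f y * (f x * f z) = f y * (f z * f x)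

/-- The value of a word under a map from letters to a monoid. -/
def wordProd {M : Type} [Monoid M] (f : ℤ → M) (l : List ℤ) : M := (l.map f).prod

section Words

variable {M : Type} [Monoid M] {f : ℤ → M}

@[simp] lemma wordProd_nil : wordProd f [] = 1 := rfl

@[simp] lemma wordProd_cons (x : ℤ) (l : List ℤ) :
    wordProd f (x :: l) = f x * wordProd f l := by
  simp [wordProd]

@[simp] lemma wordProd_append (l l' : List ℤ) :
    wordProd f (l ++ l') = wordProd f l * wordProd f l' := by
  simp [wordProd]

/-- `RowDom B D`: `D` is at least as long as `B` and is bounded above by `B` entrywise. -/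
def RowDom : List ℤ → List ℤ → Prop
  | [], _ => True
  | _ :: _, [] => False
  | b :: B, d :: D => d ≤ b ∧ RowDom B D

lemma RowDom.cons_right {B D : List ℤ} {d : ℤ} (h : RowDom B D)
    (hd : (d :: D).Pairwise (· < ·)) : RowDom B (d :: D) := by
  induction B generalizing D d with
  | nil => trivial
  | cons b B ih =>
    cases D with
    | nil => exact h.elim
    | cons e D =>
      rw [List.pairwise_cons] at hd
      exact ⟨(hd.1 e (by simp)).le.trans h.1, ih h.2 hd.2⟩

namespace KKnuth

lemma idem_tail (hf : KKnuth f) (x : ℤ) (m : M) : f x * (f x * m) = f x * m := by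
  rw [← mul_assoc, hf.idem]

lemma braid_tail (hf : KKnuth f) (x y : ℤ) (m : M) :
    f x * (f y * (f x * m)) = f y * (f x * (f y * m)) := by
  have := congrArg (· * m) (hf.braid x y)
  simpa only [mul_assoc] using this

lemma left_tail (hf : KKnuth f) {x y z : ℤ} (h : x < y) (h' : y < z) (m : M) :
    f x * (f z * (f y * m)) = f z * (f x * (f y * m)) := by
  have := congrArg (· * m) (hf.left x y z h h')
  simpa only [mul_assoc] using this

lemma right_tail (hf : KKnuth f) {x y z : ℤ} (h : x < y) (h' : y < z) (m : M) :
    f y * (f x * (f z * m)) = f y * (f z * (f x * m)) := by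
  have := congrArg (· * m) (hf.right x y z h h')
  simpa only [mul_assoc] using this

lemma row_mul_small (hf : KKnuth f) {x b : ℤ} {B : List ℤ} (hx : x < b)
    (hB : (b :: B).Pairwise (· < ·)) (m : M) :
    f b * (wordProd f B * (f x * m)) = f b * (f x * (wordProd f B * m)) := by
  induction B generalizing b with
  | nil => simp
  | cons c B ih =>
    have hbc : b < c := (List.pairwise_cons.1 hB).1 c (by simp)
    simp only [wordProd_cons, mul_assoc]
    rw [ih (hx.trans hbc) (List.pairwise_cons.1 hB).2, hf.right_tail hx hbc]

lemma row_absorb_aux (hf : KKnuth f) (B : List ℤ) : ∀ (D : List ℤ) (x : ℤ) (m : M),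
    (x :: B).Pairwise (· < ·) → (x :: D).Pairwise (· < ·) → RowDom B D →
    (f x * (wordProd f B * (f x * (wordProd f D * m))) =
      wordProd f B * (f x * (wordProd f D * m))) ∧
    ((∀ b ∈ B.head?, ∀ d ∈ D.head?, d < b) →
      wordProd f B * (f x * (wordProd f D * m)) =
        f x * (wordProd f B * (wordProd f D * m))) ∧
    ∃ q : M, wordProd f B * (f x * (wordProd f D * m)) = f x * q := by
  induction B with
  | nil =>
    intro D x m _ _ _
    exact ⟨by simp [hf.idem_tail], fun _ => by simp, wordProd f D * m, by simp⟩
  | cons b B ih =>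
    intro D x m hB hD hBD
    cases D with
    | nil => exact hBD.elim
    | cons d D =>
      obtain ⟨hdb, hBD⟩ := hBD
      obtain ⟨hxB, hB'⟩ := List.pairwise_cons.1 hB
      obtain ⟨hxD, hD'⟩ := List.pairwise_cons.1 hD
      have hxb : x < b := hxB b (by simp)
      have hxd : x < d := hxD d (by simp)
      have hdB : (d :: B).Pairwise (· < ·) :=
        List.pairwise_cons.2 ⟨fun c hc => hdb.trans_lt ((List.pairwise_cons.1 hB').1 c hc),
          (List.pairwise_cons.1 hB').2⟩
      have hW : d < b → wordProd f (b :: B) * (f x * (wordProd f (d :: D) * m)) =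
          f x * (wordProd f (b :: B) * (wordProd f (d :: D) * m)) := by
        intro hlt
        obtain ⟨-, -, q, hq⟩ := ih D d m hdB hD' hBD
        simp only [wordProd_cons, mul_assoc]
        rw [hf.row_mul_small hxb hB', hq, hf.left_tail hxd hlt]
      rcases hdb.lt_or_eq with hlt | rfl
      · have h := hW hlt
        refine ⟨?_, fun _ => h, _, h⟩
        rw [h, hf.idem_tail]
      · obtain ⟨hP, -, -⟩ := ih D d m hdB hD' hBD
        have key : wordProd f (d :: B) * (f x * (wordProd f (d :: D) * m)) =
            f d * (f x * (wordProd f B * (f d * (wordProd f D * m)))) := by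
          simp only [wordProd_cons, mul_assoc]
          rw [hf.row_mul_small hxb hB']
        have key' : wordProd f (d :: B) * (f x * (wordProd f (d :: D) * m)) =
            f x * (f d * (f x * (wordProd f B * (f d * (wordProd f D * m))))) := by
          rw [key, hf.braid_tail, hP]
        refine ⟨?_, fun h => absurd (h d (by simp) d (by simp)) (lt_irrefl _), _, key'⟩
        rw [key', hf.idem_tail]

/-- A letter may be dropped from the front of a row if the next row begins with it. -/
lemma row_absorb (hf : KKnuth f) {B D : List ℤ} {x : ℤ} (m : M)
    (hB : (x :: B).Pairwise (· < ·)) (hD : (x :: D).Pairwise (· < ·)) (h : RowDom B D) :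
    f x * (wordProd f B * (f x * (wordProd f D * m))) =
      wordProd f B * (f x * (wordProd f D * m)) :=
  (hf.row_absorb_aux B D x m hB hD h).1

/-- The first letter of a row commutes with the row below it. -/
lemma row_comm (hf : KKnuth f) {B D : List ℤ} {x : ℤ} (m : M)
    (hB : (x :: B).Pairwise (· < ·)) (hD : (x :: D).Pairwise (· < ·)) (h : RowDom B D)
    (h' : ∀ b ∈ B.head?, ∀ d ∈ D.head?, d < b) :
    wordProd f B * (f x * (wordProd f D * m)) =
      f x * (wordProd f B * (wordProd f D * m)) :=
  (hf.row_absorb_aux B D x m hB hD h).2.1 h'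

lemma row_comm_list (hf : KKnuth f) {B D : List ℤ} {x : ℤ} (C : List ℤ) (m : M)
    (hB : (x :: B).Pairwise (· < ·)) (hD : (C ++ x :: D).Pairwise (· < ·)) (h : RowDom B D) :
    wordProd f B * (wordProd f C * (f x * (wordProd f D * m))) =
      wordProd f C * (wordProd f B * (f x * (wordProd f D * m))) := by
  have hBx : ∀ b ∈ B, x < b := (List.pairwise_cons.1 hB).1
  have key : ∀ C : List ℤ, (C ++ x :: D).Pairwise (· < ·) →
      RowDom B (C ++ x :: D) ∧ wordProd f B * (wordProd f C * (f x * (wordProd f D * m))) =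
      wordProd f C * (wordProd f B * (f x * (wordProd f D * m))) := by
    intro C
    induction C with
    | nil => exact fun hD => ⟨h.cons_right hD, by simp⟩
    | cons c C ih =>
      intro hD
      rw [List.cons_append] at hD
      obtain ⟨hc, hD'⟩ := List.pairwise_cons.1 hD
      obtain ⟨hdom, he⟩ := ih hD'
      refine ⟨hdom.cons_right hD, ?_⟩
      have hcx : c < x := hc x (by simp)
      have := hf.row_comm (x := c) m
        (List.pairwise_cons.2 ⟨fun b hb => hcx.trans (hBx b hb), (List.pairwise_cons.1 hB).2⟩)
        hD hdom (by
          intro b hb d hd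
          have hxb := hBx b (List.mem_of_mem_head? hb)
          cases C with
          | nil => simp at hd; omega
          | cons e C =>
            simp at hd
            have : e < x := (List.pairwise_append.1 hD').2.2 e (by simp) x (by simp)
            omega)
      simp only [wordProd_append, wordProd_cons, mul_assoc] at this ⊢
      rw [this, he]
  exact (key C hD).2

open MulOpposite in
lemma dual (hf : KKnuth f) : KKnuth (fun x => op (f (-x))) where
  idem x := by rw [← op_mul, hf.idem]
  braid x y := by simp only [← op_mul, mul_assoc]; rw [hf.braid]
  left x y z h h' := by
    simp only [← op_mul, mul_assoc]
    rw [hf.right (-z) (-y) (-x) (by omega) (by omega)]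
  right x y z h h' := by
    simp only [← op_mul, mul_assoc]
    rw [hf.left (-z) (-y) (-x) (by omega) (by omega)]

open MulOpposite in
lemma wordProd_dual (l : List ℤ) :
    wordProd (fun x => op (f (-x))) (l.reverse.map (- ·)) = op (wordProd f l) := by
  induction l with
  | nil => simp
  | cons x l ih =>
    simp only [List.reverse_cons, List.map_append, wordProd_append, ih]
    simp

lemma pairwise_dual {l : List ℤ} (h : l.Pairwise (· < ·)) :
    (l.reverse.map (- ·)).Pairwise (· < ·) := by
  rw [List.pairwise_map, List.pairwise_reverse]
  exact h.imp (by intros; omega)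

open MulOpposite in
/-- The last letter of a row commutes with the row above it. -/
lemma row_comm_last (hf : KKnuth f) {A C : List ℤ} {x : ℤ}
    (hA : (A ++ [x]).Pairwise (· < ·)) (hC : (C ++ [x]).Pairwise (· < ·))
    (h : RowDom (C.reverse.map (- ·)) (A.reverse.map (- ·)))
    (h' : ∀ c ∈ C.getLast?, ∀ a ∈ A.getLast?, c < a) :
    wordProd f A * (f x * wordProd f C) = wordProd f A * (wordProd f C * f x) := by
  have := hf.dual.row_comm (x := -x) 1 (by simpa using pairwise_dual hC)
    (by simpa using pairwise_dual hA) h (by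
      intro b hb d hd
      simp only [List.head?_map, List.head?_reverse, Option.mem_def, Option.map_eq_some_iff]
        at hb hd
      obtain ⟨c, hc, rfl⟩ := hb
      obtain ⟨a, ha, rfl⟩ := hd
      have := h' c hc a ha
      omega)
  simp only [wordProd_dual, neg_neg, mul_one, ← op_mul, mul_assoc] at this
  exact op_injective this

/-- A letter may be deleted from a row if it occurs directly above in the next row. -/
lemma delete (hf : KKnuth f) {A B C D : List ℤ} {x : ℤ}
    (hAB : (A ++ x :: B).Pairwise (· < ·)) (hCD : (C ++ x :: D).Pairwise (· < ·))
    (hBD : RowDom B D) (hAC : RowDom (C.reverse.map (- ·)) (A.reverse.map (- ·)))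
    (hlast : ∀ c ∈ C.getLast?, ∀ a ∈ A.getLast?, c < a) :
    wordProd f (A ++ x :: B) * wordProd f (C ++ x :: D) =
      wordProd f (A ++ B) * wordProd f (C ++ x :: D) := by
  have hA : (A ++ [x]).Pairwise (· < ·) :=
    hAB.sublist (List.Sublist.append_left (by simp) _)
  have hC : (C ++ [x]).Pairwise (· < ·) :=
    hCD.sublist (List.Sublist.append_left (by simp) _)
  have hB : (x :: B).Pairwise (· < ·) := (List.pairwise_append.1 hAB).2.1
  have hD : (x :: D).Pairwise (· < ·) := (List.pairwise_append.1 hCD).2.1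
  have h1 := hf.row_comm_list C 1 hB hCD hBD
  have h2 := hf.row_comm_last hA hC hAC hlast
  have h3 := hf.row_absorb 1 hB hD hBD
  simp only [mul_one] at h1 h3
  simp only [wordProd_append, wordProd_cons, mul_assoc]
  rw [h1]
  have h2' : wordProd f A * (f x * (wordProd f C * (wordProd f B * (f x * wordProd f D)))) =
      wordProd f A * (wordProd f C * (f x * (wordProd f B * (f x * wordProd f D)))) := by
    have := congrArg (· * (wordProd f B * (f x * wordProd f D))) h2
    simpa only [mul_assoc] using this
  rw [h2', h3]

open MulOpposite in
/-- A letter may be deleted from a row if it occurs directly below in the previous row. -/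
lemma delete_upper (hf : KKnuth f) {A B E F : List ℤ} {y : ℤ}
    (hAB : (A ++ y :: B).Pairwise (· < ·)) (hEF : (E ++ y :: F).Pairwise (· < ·))
    (hFB : RowDom F B) (hAE : RowDom (A.reverse.map (- ·)) (E.reverse.map (- ·)))
    (hhead : ∀ b ∈ B.head?, ∀ e ∈ F.head?, b < e) :
    wordProd f (E ++ y :: F) * wordProd f (A ++ y :: B) =
      wordProd f (E ++ y :: F) * wordProd f (A ++ B) := by
  have inv : ∀ l : List ℤ, ((l.reverse.map (- ·)).reverse.map (- ·)) = l := by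
    intro l; simp [List.map_reverse]
  have := hf.dual.delete (A := B.reverse.map (- ·)) (B := A.reverse.map (- ·))
    (C := F.reverse.map (- ·)) (D := E.reverse.map (- ·)) (x := -y)
    (by simpa using pairwise_dual hAB) (by simpa using pairwise_dual hEF)
    hAE (by rw [inv, inv]; exact hFB) (by
      intro c hc a ha
      simp only [List.getLast?_map, List.getLast?_reverse, Option.mem_def,
        Option.map_eq_some_iff] at hc ha
      obtain ⟨c, hc, rfl⟩ := hc
      obtain ⟨a, ha, rfl⟩ := ha
      have := hhead a ha c hc
      omega)
  simp only [wordProd_append, wordProd_cons, wordProd_dual, neg_neg, ← op_mul, mul_assoc] at this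
  have := op_injective this
  simpa only [wordProd_append, wordProd_cons, mul_assoc] using this

end KKnuth

end Words

lemma rowDom_filterMap {l : List ℕ} {β δ : ℕ → Option ℤ}
    (h : ∀ j ∈ l, ∀ b, β j = some b → ∃ d, δ j = some d ∧ d ≤ b)
    (hδ : (l.filterMap δ).Pairwise (· < ·)) : RowDom (l.filterMap β) (l.filterMap δ) := by
  induction l with
  | nil => trivial
  | cons j l ih =>
    rcases hd : δ j with _ | d
    · rcases hb : β j with _ | b
      · rw [List.filterMap_cons_none hd] at hδ ⊢
        rw [List.filterMap_cons_none hb]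
        exact ih (fun k hk => h k (List.mem_cons_of_mem _ hk)) hδ
      · obtain ⟨d, hd', -⟩ := h j (by simp) b hb
        rw [hd] at hd'
        cases hd'
    · rw [List.filterMap_cons_some hd] at hδ ⊢
      have := ih (fun k hk => h k (List.mem_cons_of_mem _ hk)) (List.pairwise_cons.1 hδ).2
      rcases hb : β j with _ | b
      · rw [List.filterMap_cons_none hb]
        exact this.cons_right hδ
      · rw [List.filterMap_cons_some hb]
        obtain ⟨d', hd', hle⟩ := h j (by simp) b hb
        rw [hd] at hd'
        cases hd'
        exact ⟨hle, this⟩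

lemma map_neg_reverse_filterMap (l : List ℕ) (γ : ℕ → Option ℤ) :
    (l.filterMap γ).reverse.map (- ·) = l.reverse.filterMap fun j => (γ j).map (- ·) := by
  rw [← List.filterMap_reverse, List.map_filterMap]

lemma rowDom_neg_filterMap {l : List ℕ} {α γ : ℕ → Option ℤ}
    (h : ∀ j ∈ l, ∀ c, γ j = some c → ∃ a, α j = some a ∧ c ≤ a)
    (hα : (l.filterMap α).Pairwise (· < ·)) :
    RowDom ((l.filterMap γ).reverse.map (- ·)) ((l.filterMap α).reverse.map (- ·)) := by
  have := KKnuth.pairwise_dual hα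
  rw [map_neg_reverse_filterMap] at this
  rw [map_neg_reverse_filterMap, map_neg_reverse_filterMap]
  refine rowDom_filterMap (fun j hj b hb => ?_) this
  obtain ⟨c, hc, rfl⟩ := Option.map_eq_some_iff.1 hb
  obtain ⟨a, ha, hle⟩ := h j (by simpa using hj) c hc
  exact ⟨-a, by simp [ha], by omega⟩

lemma le_getLast_of_pairwise {l : List ℤ} (h : l.Pairwise (· < ·)) {a x : ℤ} (hx : x ∈ l)
    (ha : a ∈ l.getLast?) : x ≤ a := by
  obtain ⟨l', rfl⟩ := List.mem_getLast?_eq_getLast ha |>.elim fun h' e =>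
    (⟨l.dropLast, by rw [e]; exact (List.dropLast_append_getLast h').symm⟩ :
      ∃ l', l = l' ++ [a])
  rw [List.pairwise_append] at h
  rcases List.mem_append.1 hx with hx | hx
  · exact (h.2.2 x hx a (by simp)).le
  · simp at hx; exact hx.le

lemma head_le_of_pairwise {l : List ℤ} (h : l.Pairwise (· < ·)) {a x : ℤ} (hx : x ∈ l)
    (ha : a ∈ l.head?) : a ≤ x := by
  cases l with
  | nil => simp at hx
  | cons b l =>
    simp only [List.head?_cons, Option.mem_def, Option.some.injEq] at ha
    subst ha
    rcases List.mem_cons.1 hx with rfl | hx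
    · exact le_rfl
    · exact ((List.pairwise_cons.1 h).1 x hx).le

lemma pairwise_filterMap_of_lt {l : List ℕ} (hl : l.Pairwise (· < ·)) {α : ℕ → Option ℤ}
    (h : ∀ j j' x y, j < j' → α j = some x → α j' = some y → x < y) :
    (l.filterMap α).Pairwise (· < ·) := by
  rw [List.pairwise_filterMap]
  exact hl.imp fun hjj' x hx y hy => h _ _ x y hjj' hx hy

lemma pairwise_append_cons {A B : List ℤ} {x : ℤ} (hA : A.Pairwise (· < ·))
    (hB : B.Pairwise (· < ·)) (hAx : ∀ a ∈ A, a < x) (hxB : ∀ b ∈ B, x < b) :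
    (A ++ x :: B).Pairwise (· < ·) := by
  rw [List.pairwise_append, List.pairwise_cons]
  refine ⟨hA, ⟨hxB, hB⟩, fun a ha b hb => ?_⟩
  rcases List.mem_cons.1 hb with rfl | hb
  · exact hAx a ha
  · exact (hAx a ha).trans (hxB b hb)

/-- The entries of row `i` of `T` in the columns listed in `l`. -/
def rowList (T : ℕ × ℕ → Option ℤ) (i : ℕ) (l : List ℕ) : List ℤ := l.filterMap fun j => T (i, j)

lemma mem_rowList {T : ℕ × ℕ → Option ℤ} {i : ℕ} {l : List ℕ} {x : ℤ} :
    x ∈ rowList T i l ↔ ∃ j ∈ l, T (i, j) = some x := List.mem_filterMap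

lemma Increasing.pairwise_rowList {T : ℕ × ℕ → Option ℤ} (hT : Increasing T) (i : ℕ)
    {l : List ℕ} (hl : l.Pairwise (· < ·)) : (rowList T i l).Pairwise (· < ·) :=
  pairwise_filterMap_of_lt hl fun _ _ _ _ h hx hy => hT.row h hx hy

section Step

variable {M : Type} [Monoid M] {f : ℤ → M}
variable {lam nu C : Finset (ℕ × ℕ)} {T : ℕ × ℕ → Option ℤ}

lemma wordProd_concat_idem (hf : KKnuth f) {A B : List ℤ} {x : ℤ} (h : ∃ A', A = A' ++ [x]) :
    wordProd f (A ++ x :: B) = wordProd f (A ++ B) := by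
  obtain ⟨A', rfl⟩ := h
  simp only [wordProd_append, wordProd_cons, wordProd_nil, mul_one, mul_assoc, hf.idem_tail]

lemma wordProd_cons_idem (hf : KKnuth f) {A B : List ℤ} {x : ℤ} (h : ∃ B', B = x :: B') :
    wordProd f (A ++ x :: B) = wordProd f (A ++ B) := by
  obtain ⟨B', rfl⟩ := h
  simp only [wordProd_append, wordProd_cons, hf.idem_tail]

lemma range'_pairwise (j m : ℕ) : (List.range' j m).Pairwise (· < ·) :=
  List.pairwise_lt_range'

/-- Removing the old entry of an affected box. -/
lemma word_remove (hs : SlideSite lam nu C T) (hT : Increasing T) (hf : KKnuth f)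
    {i j m : ℕ} {x : ℤ} (ha : Affected T C i j) (hx : T (i, j) = some x)
    (up : List ℤ) (hup : ∀ i', i = i' + 1 →
      up = rowList (slide T C) i' (List.range j ++ j :: List.range' (j + 1) m)) :
    wordProd f (rowList (slide T C) i (List.range j) ++
        x :: rowList T i (List.range' (j + 1) m)) * wordProd f up =
      wordProd f (rowList (slide T C) i (List.range j) ++
        rowList T i (List.range' (j + 1) m)) * wordProd f up := by
  have hT' := hs.slide_increasing hT
  by_cases hleft : ∃ j', j = j' + 1 ∧ slide T C (i, j') = some x
  · obtain ⟨j', rfl, h⟩ := hleft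
    rw [wordProd_concat_idem hf]
    refine ⟨rowList (slide T C) i (List.range j'), ?_⟩
    simp [rowList, List.range_succ, List.filterMap_append, h]
  obtain ⟨i', rfl, h⟩ : ∃ i', i = i' + 1 ∧ slide T C (i', j) = some x := by
    cases ha with
    | dot h => rw [hs.none_of_le h le_rfl] at hx; cases hx
    | @right _ j' v h1 h2 h3 =>
      rw [h2] at hx; cases hx
      exact absurd ⟨j', rfl, by rw [slide_of_affected h1, h3]⟩ hleft
    | @down i' _ v h1 h2 h3 =>
      rw [h2] at hx; cases hx
      exact ⟨i', rfl, by rw [slide_of_affected h1, h3]⟩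
  have hlt : ∀ j' < j, ∀ a, slide T C (i' + 1, j') = some a → a < x := by
    intro j' hj' a ha'
    obtain ⟨k, rfl⟩ : ∃ k, j = k + 1 := ⟨j - 1, by omega⟩
    have hk : slide T C (i' + 1, k) ≠ none := by
      rcases Nat.lt_or_ge j' k with hlt | hge
      · have : T (i' + 1, k) ≠ none :=
          hs.ne_none_of_between (p := (i' + 1, j')) (r := (i' + 1, k + 1))
            (SlideSite.mem_or_of_slide_ne_none (by simp [ha']))
            (by simp [Prod.mk_lt_mk, hlt]) (by simp [Prod.le_def]) (by simp [hx])
        exact hs.slide_ne_none (r := (i' + 1, k + 1)) (.inr this) (by simp [Prod.mk_lt_mk])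
          (by simp [hx])
      · obtain rfl : j' = k := by omega
        simp [ha']
    obtain ⟨z, hz⟩ := Option.ne_none_iff_exists'.1 hk
    have h1 := SlideSite.slide_le_right hT hz hx
    have h2 : z ≠ x := by rintro rfl; exact hleft ⟨k, rfl, hz⟩
    rcases Nat.lt_or_ge j' k with hlt | hge
    · have := hT'.row hlt ha' hz
      omega
    · obtain rfl : j' = k := by omega
      rw [hz] at ha'; cases ha'
      omega
  have hAC : ∀ j' ∈ List.range j, ∀ c, slide T C (i', j') = some c →
      ∃ a, slide T C (i' + 1, j') = some a ∧ c < a := by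
    intro j' hj' c hc
    rw [List.mem_range] at hj'
    have h1 : T (i' + 1, j') ≠ none :=
      hs.ne_none_of_between (p := (i', j')) (r := (i' + 1, j))
        (SlideSite.mem_or_of_slide_ne_none (by simp [hc]))
        (by simp [Prod.mk_lt_mk]) (by simp [Prod.le_def]; omega) (by simp [hx])
    have h2 : slide T C (i' + 1, j') ≠ none :=
      hs.slide_ne_none (r := (i' + 1, j)) (.inr h1) (by simp [Prod.mk_lt_mk, hj']) (by simp [hx])
    obtain ⟨a, ha'⟩ := Option.ne_none_iff_exists'.1 h2
    exact ⟨a, ha', hT'.col (Nat.lt_succ_self _) hc ha'⟩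
  have hBD : ∀ j' ∈ List.range' (j + 1) m, ∀ b, T (i' + 1, j') = some b →
      ∃ d, slide T C (i', j') = some d ∧ d ≤ b := by
    intro j' hj' b hb
    have hj' : j < j' := by simp [List.mem_range'] at hj'; omega
    have h1 : T (i', j') ≠ none :=
      hs.ne_none_of_between (p := (i', j)) (r := (i' + 1, j'))
        (SlideSite.mem_or_of_slide_ne_none (by simp [h]))
        (by simp [Prod.mk_lt_mk, hj']) (by simp [Prod.le_def]) (by simp [hb])
    have h2 : slide T C (i', j') ≠ none :=
      hs.slide_ne_none (r := (i' + 1, j')) (.inr h1) (by simp [Prod.mk_lt_mk]) (by simp [hb])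
    obtain ⟨d, hd⟩ := Option.ne_none_iff_exists'.1 h2
    exact ⟨d, hd, SlideSite.slide_le_down hT hd hb⟩
  have hupe : up = rowList (slide T C) i' (List.range j) ++
      x :: rowList (slide T C) i' (List.range' (j + 1) m) := by
    rw [hup i' rfl]
    simp [rowList, List.filterMap_append, h]
  rw [hupe]
  have pr := List.pairwise_lt_range (n := j)
  have pr' := range'_pairwise (j + 1) m
  have mr' : ∀ j' ∈ List.range' (j + 1) m, j < j' := fun j' hj' => by
    simp [List.mem_range'] at hj'; omega
  refine hf.delete
    (pairwise_append_cons (hT'.pairwise_rowList _ pr) (hT.pairwise_rowList _ pr') ?_ ?_)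
    (pairwise_append_cons (hT'.pairwise_rowList _ pr) (hT'.pairwise_rowList _ pr') ?_ ?_)
    (rowDom_filterMap hBD (hT'.pairwise_rowList _ pr'))
    (rowDom_neg_filterMap (fun j' hj' c hc => ?_) (hT'.pairwise_rowList _ pr)) ?_
  · intro a ha'
    obtain ⟨j', hj', ha'⟩ := mem_rowList.1 ha'
    exact hlt j' (List.mem_range.1 hj') a ha'
  · intro b hb
    obtain ⟨j', hj', hb⟩ := mem_rowList.1 hb
    exact hT.row (mr' j' hj') hx hb
  · intro a ha'
    obtain ⟨j', hj', ha'⟩ := mem_rowList.1 ha'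
    exact hT'.row (List.mem_range.1 hj') ha' h
  · intro b hb
    obtain ⟨j', hj', hb⟩ := mem_rowList.1 hb
    exact hT'.row (mr' j' hj') h hb
  · obtain ⟨a, h1, h2⟩ := hAC j' hj' c hc
    exact ⟨a, h1, h2.le⟩
  · intro c hc a ha'
    obtain ⟨j', hj', hc⟩ := mem_rowList.1 (List.mem_of_getLast? hc)
    obtain ⟨a', h1, h2⟩ := hAC j' hj' c hc
    exact h2.trans_le (le_getLast_of_pairwise (hT'.pairwise_rowList _ pr)
      (mem_rowList.2 ⟨j', hj', h1⟩) ha')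

/-- Inserting the new entry of an affected box. -/
lemma word_insert (hs : SlideSite lam nu C T) (hT : Increasing T) (hf : KKnuth f)
    {i j m : ℕ} {y : ℤ} (ha : Affected T C i j) (hy : nextVal T i j = some y)
    (hm : ∀ j', T (i, j') ≠ none → j' < j + 1 + m) :
    wordProd f (rowList T (i + 1) (List.range j ++ j :: List.range' (j + 1) m)) *
      wordProd f (rowList (slide T C) i (List.range j) ++
        y :: rowList T i (List.range' (j + 1) m)) =
    wordProd f (rowList T (i + 1) (List.range j ++ j :: List.range' (j + 1) m)) *
      wordProd f (rowList (slide T C) i (List.range j) ++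
        rowList T i (List.range' (j + 1) m)) := by
  have hT' := hs.slide_increasing hT
  have hsl : slide T C (i, j) = some y := by rw [slide_of_affected ha, hy]
  by_cases hright : T (i, j + 1) = some y
  · rw [wordProd_cons_idem hf]
    obtain ⟨m', rfl⟩ : ∃ m', m = m' + 1 :=
      ⟨m - 1, by have := hm (j + 1) (by simp [hright]); omega⟩
    exact ⟨rowList T i (List.range' (j + 1 + 1) m'), by simp [List.range'_succ, rowList, hright]⟩
  have hdown : T (i + 1, j) = some y := (nextVal_eq_some.1 hy).1.resolve_left hright
  have mr' : ∀ j' ∈ List.range' (j + 1) m, j < j' := fun j' hj' => by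
    simp [List.mem_range'] at hj'; omega
  have hlt : ∀ j', j < j' → ∀ b, T (i, j') = some b → y < b := by
    intro j' hj' b hb
    have h1 : T (i, j + 1) ≠ none :=
      hs.ne_none_of_between (p := (i, j)) (r := (i, j'))
        (SlideSite.mem_or_of_slide_ne_none (by simp [hsl])) (by simp [Prod.mk_lt_mk])
        (by simp [Prod.le_def]; omega) (by simp [hb])
    obtain ⟨z, hz⟩ := Option.ne_none_iff_exists'.1 h1
    have h2 := (nextVal_eq_some.1 hy).2.1 z hz
    have h3 : z ≠ y := by rintro rfl; exact hright hz
    rcases Nat.lt_or_ge (j + 1) j' with h4 | h4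
    · have := hT.row h4 hz hb
      omega
    · obtain rfl : j' = j + 1 := by omega
      rw [hz] at hb; cases hb
      omega
  have hFB : ∀ j' ∈ List.range' (j + 1) m, ∀ e, T (i + 1, j') = some e →
      ∃ b, T (i, j') = some b ∧ b < e := by
    intro j' hj' e he
    have h1 : T (i, j') ≠ none :=
      hs.ne_none_of_between (p := (i, j)) (r := (i + 1, j'))
        (SlideSite.mem_or_of_slide_ne_none (by simp [hsl])) (by simp [Prod.mk_lt_mk, mr' j' hj'])
        (by simp [Prod.le_def]) (by simp [he])
    obtain ⟨b, hb⟩ := Option.ne_none_iff_exists'.1 h1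
    exact ⟨b, hb, hT.col (Nat.lt_succ_self _) hb he⟩
  have hAE : ∀ j' ∈ List.range j, ∀ a, slide T C (i, j') = some a →
      ∃ e, T (i + 1, j') = some e ∧ a ≤ e := by
    intro j' hj' a ha'
    rw [List.mem_range] at hj'
    have h1 : T (i + 1, j') ≠ none :=
      hs.ne_none_of_between (p := (i, j')) (r := (i + 1, j))
        (SlideSite.mem_or_of_slide_ne_none (by simp [ha'])) (by simp [Prod.mk_lt_mk])
        (by simp [Prod.le_def]; omega) (by simp [hdown])
    obtain ⟨e, he⟩ := Option.ne_none_iff_exists'.1 h1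
    exact ⟨e, he, SlideSite.slide_le_down hT ha' he⟩
  have hdn : rowList T (i + 1) (List.range j ++ j :: List.range' (j + 1) m) =
      rowList T (i + 1) (List.range j) ++ y :: rowList T (i + 1) (List.range' (j + 1) m) := by
    simp [rowList, List.filterMap_append, hdown]
  rw [hdn]
  have pr := List.pairwise_lt_range (n := j)
  have pr' := range'_pairwise (j + 1) m
  refine hf.delete_upper
    (pairwise_append_cons (hT'.pairwise_rowList _ pr) (hT.pairwise_rowList _ pr') ?_ ?_)
    (pairwise_append_cons (hT.pairwise_rowList _ pr) (hT.pairwise_rowList _ pr') ?_ ?_)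
    (rowDom_filterMap (fun j' hj' e he => ?_) (hT.pairwise_rowList _ pr'))
    (rowDom_neg_filterMap hAE (hT.pairwise_rowList _ pr)) ?_
  · intro a ha'
    obtain ⟨j', hj', ha'⟩ := mem_rowList.1 ha'
    exact hT'.row (List.mem_range.1 hj') ha' hsl
  · intro b hb
    obtain ⟨j', hj', hb⟩ := mem_rowList.1 hb
    exact hlt j' (mr' j' hj') b hb
  · intro a ha'
    obtain ⟨j', hj', ha'⟩ := mem_rowList.1 ha'
    exact hT.row (List.mem_range.1 hj') ha' hdown
  · intro b hb
    obtain ⟨j', hj', hb⟩ := mem_rowList.1 hb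
    exact hT.row (mr' j' hj') hdown hb
  · obtain ⟨b, h1, h2⟩ := hFB j' hj' e he
    exact ⟨b, h1, h2.le⟩
  · intro b hb e he
    obtain ⟨j', hj', he⟩ := mem_rowList.1 (List.mem_of_head? he)
    obtain ⟨b', h1, h2⟩ := hFB j' hj' e he
    exact (head_le_of_pairwise (hT.pairwise_rowList _ pr')
      (mem_rowList.2 ⟨j', hj', h1⟩) hb).trans_lt h2

end Step

section Assembly

variable {M : Type} [Monoid M] {f : ℤ → M}
variable {lam nu C : Finset (ℕ × ℕ)} {T : ℕ × ℕ → Option ℤ}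

lemma range_split (j m : ℕ) :
    List.range (j + 1 + m) = List.range j ++ j :: List.range' (j + 1) m := by
  rw [List.range_add, List.range_succ, List.append_assoc, List.range'_eq_map_range]
  rfl

lemma word_step (hs : SlideSite lam nu C T) (hT : Increasing T) (hf : KKnuth f)
    {i j m : ℕ} (up : List ℤ) (hup : ∀ i', i = i' + 1 →
      up = rowList (slide T C) i' (List.range (j + 1 + m)))
    (hm : ∀ j', T (i, j') ≠ none → j' < j + 1 + m) :
    wordProd f (rowList T (i + 1) (List.range (j + 1 + m))) *
      (wordProd f (rowList (slide T C) i (List.range j) ++ rowList T i (List.range' j (m + 1))) *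
        wordProd f up) =
    wordProd f (rowList T (i + 1) (List.range (j + 1 + m))) *
      (wordProd f (rowList (slide T C) i (List.range (j + 1)) ++
        rowList T i (List.range' (j + 1) m)) * wordProd f up) := by
  rw [range_split] at hup ⊢
  have e1 : rowList T i (List.range' j (m + 1)) =
      (T (i, j)).toList ++ rowList T i (List.range' (j + 1) m) := by
    rcases h : T (i, j) with _ | x <;> simp [rowList, List.range'_succ, h]
  have e2 : rowList (slide T C) i (List.range (j + 1)) =
      rowList (slide T C) i (List.range j) ++ (slide T C (i, j)).toList := by
    rcases h : slide T C (i, j) with _ | x <;> simp [rowList, List.range_succ, h]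
  rw [e1, e2]
  by_cases ha : Affected T C i j
  · have h1 : wordProd f (rowList (slide T C) i (List.range j) ++ ((T (i, j)).toList ++
        rowList T i (List.range' (j + 1) m))) * wordProd f up =
        wordProd f (rowList (slide T C) i (List.range j) ++
        rowList T i (List.range' (j + 1) m)) * wordProd f up := by
      rcases hx : T (i, j) with _ | x
      · simp
      · exact word_remove hs hT hf ha hx up hup
    have h2 : wordProd f (rowList T (i + 1) (List.range j ++ j :: List.range' (j + 1) m)) *
        wordProd f (rowList (slide T C) i (List.range j) ++ (slide T C (i, j)).toList ++
          rowList T i (List.range' (j + 1) m)) =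
        wordProd f (rowList T (i + 1) (List.range j ++ j :: List.range' (j + 1) m)) *
        wordProd f (rowList (slide T C) i (List.range j) ++
          rowList T i (List.range' (j + 1) m)) := by
      rw [slide_of_affected ha]
      rcases hy : nextVal T i j with _ | y
      · simp
      · simpa using word_insert hs hT hf ha hy hm
    rw [h1, ← mul_assoc, ← h2, mul_assoc]
  · rw [slide_of_not_affected ha, List.append_assoc]

lemma word_row (hs : SlideSite lam nu C T) (hT : Increasing T) (hf : KKnuth f)
    {i K : ℕ} (up : List ℤ) (hup : ∀ i', i = i' + 1 →
      up = rowList (slide T C) i' (List.range K))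
    (hm : ∀ j', T (i, j') ≠ none → j' < K) :
    wordProd f (rowList T (i + 1) (List.range K)) *
      (wordProd f (rowList T i (List.range K)) * wordProd f up) =
    wordProd f (rowList T (i + 1) (List.range K)) *
      (wordProd f (rowList (slide T C) i (List.range K)) * wordProd f up) := by
  have key : ∀ j m, j + m = K →
      wordProd f (rowList T (i + 1) (List.range K)) *
      (wordProd f (rowList T i (List.range K)) * wordProd f up) =
      wordProd f (rowList T (i + 1) (List.range K)) *
      (wordProd f (rowList (slide T C) i (List.range j) ++ rowList T i (List.range' j m)) *
        wordProd f up) := by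
    intro j
    induction j with
    | zero =>
      rintro m hmK
      obtain rfl : m = K := by omega
      simp [rowList, List.range_eq_range']
    | succ j ih =>
      rintro m rfl
      rw [ih (m + 1) (by omega)]
      exact word_step hs hT hf up hup hm
  simpa [rowList] using key K 0 (by simp)

/-- The value of the row word of the first `n` rows and `K` columns of `T`, bottom row first. -/
def tabProd (f : ℤ → M) (K : ℕ) (T : ℕ × ℕ → Option ℤ) : ℕ → M
  | 0 => 1
  | n + 1 => wordProd f (rowList T n (List.range K)) * tabProd f K T n

lemma tabProd_slide (hs : SlideSite lam nu C T) (hT : Increasing T) (hf : KKnuth f) {R K : ℕ}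
    (hb : BoundedBy T R K) : tabProd f K (slide T C) R = tabProd f K T R := by
  have key : ∀ n, wordProd f (rowList T n (List.range K)) * tabProd f K T n =
      wordProd f (rowList T n (List.range K)) * tabProd f K (slide T C) n := by
    intro n
    induction n with
    | zero => rfl
    | succ n ih =>
      simp only [tabProd]
      rw [ih]
      cases n with
      | zero =>
        have := word_row hs hT hf (i := 0) (K := K) [] (fun i' h => by omega)
          fun j' h => (hb _ h).2
        simpa [tabProd] using this
      | succ n =>
        have := word_row hs hT hf (i := n + 1) (K := K) (rowList (slide T C) n (List.range K))
          (fun i' h => by obtain rfl : n = i' := by omega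
                          rfl)
          fun j' h => (hb _ h).2
        have := congrArg (· * tabProd f K (slide T C) n) this
        simpa only [tabProd, mul_assoc] using this
  have := key R
  have hR : rowList T R (List.range K) = [] := by
    rw [rowList, List.filterMap_eq_nil_iff]
    intro j _
    by_contra h
    exact absurd (hb _ h).1 (lt_irrefl _)
  rw [hR] at this
  simpa using this.symm

end Assembly

lemma slides_increasing {T V : ℕ × ℕ → Option ℤ} (hT : Increasing T) {R K : ℕ}
    (hb : BoundedBy T R K) (h : Relation.ReflTransGen IsForwardSlide T V) :
    Increasing V ∧ BoundedBy V R K := by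
  induction h with
  | refl => exact ⟨hT, hb⟩
  | tail _ h ih =>
    obtain ⟨lam, nu, C, hs, rfl⟩ := h.exists_site ih.1
    exact ⟨hs.slide_increasing ih.1, ih.2.slide⟩

/-- The value of the row word is invariant under forward slides. -/
lemma tabProd_of_slides {M : Type} [Monoid M] {f : ℤ → M} (hf : KKnuth f)
    {T V : ℕ × ℕ → Option ℤ} (hT : Increasing T) {R K : ℕ} (hb : BoundedBy T R K)
    (h : Relation.ReflTransGen IsForwardSlide T V) : tabProd f K V R = tabProd f K T R := by
  induction h with
  | refl => rfl
  | tail h0 h ih =>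
    obtain ⟨h1, h2⟩ := slides_increasing hT hb h0
    obtain ⟨lam, nu, C, hs, rfl⟩ := h.exists_site h1
    rw [tabProd_slide hs h1 hf h2, ih]

/-- A family of self-maps that respects the K-Knuth relations, the leftmost letter acting first. -/
structure KKnuthAct {X : Type} (g : ℤ → X → X) : Prop where
  idem : ∀ x s, g x (g x s) = g x s
  braid : ∀ x y s, g x (g y (g x s)) = g y (g x (g y s))
  left : ∀ x y z s, x < y → y < z → g y (g z (g x s)) = g y (g x (g z s))
  right : ∀ x y z s, x < y → y < z → g z (g x (g y s)) = g x (g z (g y s))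

/-- The action of an optional letter. -/
def optAct {X : Type} (g : ℤ → X → X) : Option ℤ → X → X
  | none, s => s
  | some x, s => g x s

@[simp] lemma optAct_some {X : Type} (g : ℤ → X → X) (x : ℤ) (s : X) :
    optAct g (some x) s = g x s := rfl

/-- The action of the first `m` boxes of row `i`. -/
def rowAct {X : Type} (g : ℤ → X → X) (V : ℕ × ℕ → Option ℤ) (i : ℕ) : ℕ → X → X
  | 0, s => s
  | m + 1, s => optAct g (V (i, m)) (rowAct g V i m s)

/-- The action of the first `n` rows, the bottom row acting first. -/
def tabAct {X : Type} (g : ℤ → X → X) (V : ℕ × ℕ → Option ℤ) (K : ℕ) : ℕ → X → X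
  | 0, s => s
  | n + 1, s => tabAct g V K n (rowAct g V n K s)

/-- The monoid valued map attached to a family of self-maps. -/
def actMap {X : Type} (g : ℤ → X → X) (x : ℤ) : (Function.End X)ᵐᵒᵖ := MulOpposite.op (g x)

lemma KKnuthAct.kknuth {X : Type} {g : ℤ → X → X} (hg : KKnuthAct g) : KKnuth (actMap g) where
  idem x := MulOpposite.unop_injective (funext fun s => hg.idem x s)
  braid x y := MulOpposite.unop_injective (funext fun s => hg.braid x y s)
  left x y z h h' := MulOpposite.unop_injective (funext fun s => hg.left x y z s h h')
  right x y z h h' := MulOpposite.unop_injective (funext fun s => hg.right x y z s h h')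

lemma wordProd_actMap {X : Type} (g : ℤ → X → X) (V : ℕ × ℕ → Option ℤ) (i m : ℕ) :
    wordProd (actMap g) (rowList V i (List.range m)) = MulOpposite.op (rowAct g V i m) := by
  induction m with
  | zero => rfl
  | succ m ih =>
    have : rowList V i (List.range (m + 1)) =
        rowList V i (List.range m) ++ (V (i, m)).toList := by
      rcases h : V (i, m) with _ | x <;> simp [rowList, List.range_succ, h]
    rw [this, wordProd_append, ih]
    apply MulOpposite.unop_injective
    funext s
    rcases h : V (i, m) with _ | x
    · simp [rowAct, h]
      rfl
    · simp [rowAct, h, actMap]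
      rfl

lemma tabProd_actMap {X : Type} (g : ℤ → X → X) (V : ℕ × ℕ → Option ℤ) (K n : ℕ) :
    tabProd (actMap g) K V n = MulOpposite.op (tabAct g V K n) := by
  induction n with
  | zero => rfl
  | succ n ih =>
    rw [tabProd, ih, wordProd_actMap]
    rfl

/-- The row words of `V` and `V'` take the same values under all K-Knuth actions. -/
def WordEquiv (V V' : ℕ × ℕ → Option ℤ) : Prop :=
  ∃ R K, BoundedBy V R K ∧ BoundedBy V' R K ∧
    ∀ {X : Type} (g : ℤ → X → X), KKnuthAct g → tabAct g V K R = tabAct g V' K R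

lemma wordEquiv_of_slides {T V V' : ℕ × ℕ → Option ℤ} (hT : Increasing T) {R K : ℕ}
    (hb : BoundedBy T R K) (h : Relation.ReflTransGen IsForwardSlide T V)
    (h' : Relation.ReflTransGen IsForwardSlide T V') : WordEquiv V V' := by
  refine ⟨R, K, (slides_increasing hT hb h).2, (slides_increasing hT hb h').2, fun g hg => ?_⟩
  have e := (tabProd_of_slides hg.kknuth hT hb h).trans
    (tabProd_of_slides hg.kknuth hT hb h').symm
  rw [tabProd_actMap, tabProd_actMap] at e
  exact MulOpposite.op_injective e

section Acts

variable {X : Type} {g : ℤ → X → X} {V : ℕ × ℕ → Option ℤ}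

lemma rowAct_induct {i m : ℕ} (P : ℕ → X → Prop) {s : X} (h0 : P 0 s)
    (h : ∀ j < m, ∀ s, P j s → P (j + 1) (optAct g (V (i, j)) s)) : P m (rowAct g V i m s) := by
  induction m with
  | zero => exact h0
  | succ m ih => exact h m (Nat.lt_succ_self m) _ (ih fun j hj => h j (by omega))

lemma rowAct_induct_le {i n m : ℕ} (P : ℕ → X → Prop) {s : X} (hnm : n ≤ m)
    (h0 : P n (rowAct g V i n s))
    (h : ∀ j, n ≤ j → j < m → ∀ s, P j s → P (j + 1) (optAct g (V (i, j)) s)) :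
    P m (rowAct g V i m s) := by
  induction m, hnm using Nat.le_induction with
  | base => exact h0
  | succ m hm ih =>
    exact h m hm (Nat.lt_succ_self m) _ (ih fun j hj hj' => h j hj (by omega))

lemma rowAct_invariant {i m : ℕ} (P : X → Prop) {s : X} (h0 : P s)
    (h : ∀ j < m, ∀ x, V (i, j) = some x → ∀ s, P s → P (g x s)) : P (rowAct g V i m s) := by
  refine rowAct_induct (fun _ => P) h0 fun j hj s hs => ?_
  rcases hv : V (i, j) with _ | x
  · exact hs
  · exact h j hj x hv s hs

lemma tabAct_induct {n K : ℕ} (P : ℕ → X → Prop) {s : X} (h0 : P n s)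
    (h : ∀ i < n, ∀ s, P (i + 1) s → P i (rowAct g V i K s)) : P 0 (tabAct g V K n s) := by
  induction n generalizing s with
  | zero => exact h0
  | succ n ih => exact ih (h n (Nat.lt_succ_self n) s h0) fun i hi => h i (by omega)

lemma rowAct_eq_self {i m : ℕ} (h : ∀ j < m, V (i, j) = none) (s : X) :
    rowAct g V i m s = s := by
  refine rowAct_induct (fun _ t => t = s) rfl fun j hj t ht => ?_
  rw [h j hj]
  exact ht

lemma tabAct_eq_of_le {n n' K : ℕ} (hn : n ≤ n')
    (h : ∀ i j, n ≤ i → V (i, j) = none) (s : X) : tabAct g V K n' s = tabAct g V K n s := by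
  induction n', hn using Nat.le_induction with
  | base => rfl
  | succ m hm ih => rw [tabAct, rowAct_eq_self (fun j _ => h m j hm), ih]

end Acts

/-- The domain of `V` is a lower set. -/
def LowerShape (V : ℕ × ℕ → Option ℤ) : Prop := ∀ p q, p ≤ q → V q ≠ none → V p ≠ none

lemma HasStraightShape.lowerShape {V : ℕ × ℕ → Option ℤ} (h : HasStraightShape V) :
    LowerShape V := by
  obtain ⟨lam, h1, h2⟩ := h
  have h3 : ∀ p, V p ≠ none ↔ p ∈ lam := fun p => by simpa [shapeOf] using Set.ext_iff.1 h2 p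
  intro p q hpq hq
  rw [h3] at hq ⊢
  exact h1 q hq p hpq

lemma LowerShape.exists_left {V : ℕ × ℕ → Option ℤ} (hV : LowerShape V) (hi : Increasing V)
    {i j j' : ℕ} {x : ℤ} (h : V (i, j') = some x) (hj : j < j') :
    ∃ y, V (i, j) = some y ∧ y < x := by
  obtain ⟨y, hy⟩ := Option.ne_none_iff_exists'.1
    (hV (i, j) (i, j') (by simp [Prod.le_def]; omega) (by simp [h]))
  exact ⟨y, hy, hi.row hj hy h⟩

lemma LowerShape.exists_up {V : ℕ × ℕ → Option ℤ} (hV : LowerShape V) (hi : Increasing V)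
    {i i' j : ℕ} {x : ℤ} (h : V (i', j) = some x) (hj : i < i') :
    ∃ y, V (i, j) = some y ∧ y < x := by
  obtain ⟨y, hy⟩ := Option.ne_none_iff_exists'.1
    (hV (i, j) (i', j) (by simp [Prod.le_def]; omega) (by simp [h]))
  exact ⟨y, hy, hi.col hj hy h⟩

/-- The action of a letter on the growth function recording lengths of increasing subwords. -/
def lisAct (x : ℤ) (s : ℤ →o ℕ) : ℤ →o ℕ where
  toFun t := if x ≤ t then max (s t) (s (x - 1) + 1) else s t
  monotone' t t' h := by
    have := s.monotone h
    dsimp only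
    split_ifs <;> omega

lemma lisAct_apply (x : ℤ) (s : ℤ →o ℕ) (t : ℤ) :
    lisAct x s t = if x ≤ t then max (s t) (s (x - 1) + 1) else s t := rfl

lemma lisAct_kknuth : KKnuthAct lisAct where
  idem x s := by
    ext t
    simp only [lisAct_apply]
    grind
  braid x y s := by
    ext t
    simp only [lisAct_apply]
    have h1 : x ≤ y → s (x - 1) ≤ s (y - 1) := fun h => s.monotone (by omega)
    have h2 : y ≤ x → s (y - 1) ≤ s (x - 1) := fun h => s.monotone (by omega)
    grind
  left x y z s h h' := by
    ext t
    simp only [lisAct_apply]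
    have h1 : s (x - 1) ≤ s (y - 1) := s.monotone (by omega)
    have h2 : s (y - 1) ≤ s (z - 1) := s.monotone (by omega)
    grind
  right x y z s h h' := by
    ext t
    simp only [lisAct_apply]
    have h1 : s (x - 1) ≤ s (y - 1) := s.monotone (by omega)
    have h2 : s (y - 1) ≤ s (z - 1) := s.monotone (by omega)
    grind

lemma le_lisAct (x : ℤ) (s : ℤ →o ℕ) (t : ℤ) : s t ≤ lisAct x s t := by
  rw [lisAct_apply]
  split_ifs <;> simp

lemma exists_of_lt_lis {V : ℕ × ℕ → Option ℤ} (hV : LowerShape V) (hi : Increasing V)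
    (K n : ℕ) (k : ℕ) (t : ℤ) (h : k < tabAct lisAct V K n ⟨fun _ => 0, fun _ _ _ => le_rfl⟩ t) :
    ∃ v ≤ t, V (0, k) = some v := by
  refine tabAct_induct (fun i (s : ℤ →o ℕ) => ∀ (k : ℕ) (t : ℤ), k < s t →
    ∃ v ≤ t, V (i, k) = some v)
    ?_ ?_ k t h
  · intro k t h
    exact absurd h (Nat.not_lt_zero k)
  · intro i _ s hs
    refine rowAct_invariant (fun s : ℤ →o ℕ =>
      ∀ (k : ℕ) (t : ℤ), k < s t → ∃ v ≤ t, V (i, k) = some v) ?_ ?_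
    · intro k t h
      obtain ⟨v, hv, hv'⟩ := hs k t h
      obtain ⟨y, hy, hlt⟩ := hV.exists_up hi hv' (Nat.lt_succ_self i)
      exact ⟨y, by omega, hy⟩
    · intro m _ x hx s hs k t h
      rw [lisAct_apply] at h
      by_cases hk : k < s t
      · exact hs k t hk
      have hxt : x ≤ t ∧ k ≤ s (x - 1) := by
        split_ifs at h with h1
        · exact ⟨h1, by omega⟩
        · omega
      have hkm : k ≤ m := by
        rcases k with _ | k
        · omega
        · obtain ⟨v, hv, hv'⟩ := hs k (x - 1) (by omega)
          by_contra hlt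
          rcases Nat.lt_or_ge m k with h2 | h2
          · have := hi.row h2 hx hv'
            omega
          · obtain rfl : m = k := by omega
            rw [hx] at hv'; cases hv'
            omega
      rcases hkm.eq_or_lt with rfl | hlt
      · exact ⟨x, hxt.1, hx⟩
      · obtain ⟨y, hy, hyx⟩ := hV.exists_left hi hx hlt
        exact ⟨y, by omega, hy⟩

lemma lt_lis_of_eq_some {V : ℕ × ℕ → Option ℤ} (hV : LowerShape V) (hi : Increasing V)
    {R K : ℕ} (hb : BoundedBy V R K) (s : ℤ →o ℕ) {k : ℕ} {v t : ℤ} (h : V (0, k) = some v)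
    (hvt : v ≤ t) : k < tabAct lisAct V K R s t := by
  have hR := hb (0, k) (by simp [h])
  refine tabAct_induct (fun i s => i = 0 → k < s t) (n := R) (s := s) (fun h => ?_) ?_ rfl
  · simp only at hR; omega
  rintro i - s - rfl
  refine rowAct_induct (g := lisAct) (V := V) (i := 0) (m := K)
    (fun m s => ∀ k < m, ∀ v t, V (0, k) = some v → v ≤ t → k < s t) (by simp) ?_ k hR.2 v t h hvt
  intro m _ s hs k hk v t hv hvt
  rcases Nat.lt_succ_iff_lt_or_eq.1 hk with hk | rfl
  · have := hs k hk v t hv hvt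
    rcases V (0, m) with _ | x
    · exact this
    · exact this.trans_le (le_lisAct _ _ _)
  · rw [hv, optAct_some, lisAct_apply, if_pos hvt]
    rcases k with _ | k
    · simp
    · obtain ⟨y, hy, hyx⟩ := hV.exists_left hi hv (Nat.lt_succ_self k)
      have := hs k (Nat.lt_succ_self k) y (v - 1) hy (by omega)
      exact lt_max_of_lt_right (by omega)

/-- Word-equivalent tableaux of straight shape have the same first row. -/
lemma WordEquiv.first_row {V V' : ℕ × ℕ → Option ℤ} (h : WordEquiv V V') (hV : LowerShape V)
    (hi : Increasing V) (hV' : LowerShape V') (hi' : Increasing V') (k : ℕ) :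
    V' (0, k) = V (0, k) := by
  obtain ⟨R, K, hb, hb', he⟩ := h
  have e := he lisAct lisAct_kknuth
  have h1 : ∀ v, V (0, k) = some v → ∃ v' ≤ v, V' (0, k) = some v' := fun v hv =>
    exists_of_lt_lis hV' hi' K R k v (by rw [← e]; exact lt_lis_of_eq_some hV hi hb _ hv le_rfl)
  have h2 : ∀ v, V' (0, k) = some v → ∃ v' ≤ v, V (0, k) = some v' := fun v hv =>
    exists_of_lt_lis hV hi K R k v (by rw [e]; exact lt_lis_of_eq_some hV' hi' hb' _ hv le_rfl)
  rcases hv : V (0, k) with _ | v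
  · rcases hv' : V' (0, k) with _ | v'
    · rfl
    · obtain ⟨w, -, hw⟩ := h2 v' hv'
      rw [hv] at hw; cases hw
  · obtain ⟨v', hle, hv'⟩ := h1 v hv
    obtain ⟨w, hle', hw⟩ := h2 v' hv'
    rw [hv] at hw; cases hw
    rw [hv', le_antisymm hle hle']

/-- The action of a letter on a single particle that moves from `x` to `x + 1`. -/
def posAct (x : ℤ) (s : ℤ) : ℤ := if s = x then x + 1 else s

lemma posAct_kknuth : KKnuthAct posAct where
  idem x s := by unfold posAct; grind
  braid x y s := by unfold posAct; grind
  left x y z s h h' := by unfold posAct; grind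
  right x y z s h h' := by unfold posAct; grind

lemma le_posAct (x s : ℤ) : s ≤ posAct x s := by unfold posAct; grind

lemma le_pos_of_block {V : ℕ × ℕ → Option ℤ} {i a R K : ℕ} (hiR : i < R) (haK : a ≤ K)
    (h : ∀ j < a, V (i, j) = some (i + j + 1 : ℤ)) :
    (i + 1 + a : ℤ) ≤ tabAct posAct V K R (i + 1) := by
  have := tabAct_induct (g := posAct) (V := V) (K := K) (n := R) (s := (i + 1 : ℤ))
    (fun r s => (i + 1 : ℤ) ≤ s ∧ (r ≤ i → (i + 1 + a : ℤ) ≤ s)) ⟨le_rfl, by omega⟩ ?_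
  · exact this.2 (Nat.zero_le _)
  intro r _ s hs
  have mono : s ≤ rowAct posAct V r K s :=
    rowAct_invariant (fun t => s ≤ t) le_rfl fun j _ x _ t ht => ht.trans (le_posAct x t)
  refine ⟨hs.1.trans mono, fun hri => ?_⟩
  rcases hri.eq_or_lt with rfl | hlt
  · refine rowAct_induct_le (g := posAct) (V := V) (i := r) (m := K)
      (fun _ t => (r + 1 + a : ℤ) ≤ t) haK ?_ ?_
    · refine rowAct_induct (g := posAct) (V := V) (i := r) (m := a)
        (fun m t => (r + 1 + m : ℤ) ≤ t) (by simpa using hs.1) fun j hj t ht => ?_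
      rw [h j hj, optAct_some]
      unfold posAct
      push_cast
      grind
    · intro j _ _ t ht
      rcases V (r, j) with _ | x
      · exact ht
      · exact ht.trans (le_posAct _ _)
  · exact (hs.2 hlt).trans mono

lemma pos_lt_of_lacks {V : ℕ × ℕ → Option ℤ} (hV : LowerShape V) (hi : Increasing V)
    {R K a j₀ : ℕ} (ha : ∀ p, V p ≠ none → p.2 < a) (hj₀ : j₀ < a) (x : ℤ)
    (h : ∀ i, V (i, j₀) ≠ some (x + j₀)) : tabAct posAct V K R x < x + a := by
  have key := tabAct_induct (g := posAct) (V := V) (K := K) (n := R) (s := x)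
    (fun r s => ∃ k : ℕ, s = x + k ∧
      (1 ≤ k → k ≤ j₀ → ∃ v, V (r, k - 1) = some v ∧ v < x + k) ∧
      (j₀ < k → ∃ v, V (r, k) = some v ∧ v < x + k)) ⟨0, by simp⟩ ?_
  · obtain ⟨k, hk, -, h2⟩ := key
    have : k < a := by
      by_cases hkj : j₀ < k
      · obtain ⟨v, hv, -⟩ := h2 hkj
        exact ha (0, k) (by simp [hv])
      · omega
    omega
  intro r _ s hs
  refine rowAct_invariant (fun s => ∃ k : ℕ, s = x + k ∧
      (1 ≤ k → k ≤ j₀ → ∃ v, V (r, k - 1) = some v ∧ v < x + k) ∧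
      (j₀ < k → ∃ v, V (r, k) = some v ∧ v < x + k)) ?_ ?_
  · obtain ⟨k, hk, h1, h2⟩ := hs
    refine ⟨k, hk, fun h3 h4 => ?_, fun h3 => ?_⟩
    · obtain ⟨v, hv, hlt⟩ := h1 h3 h4
      obtain ⟨y, hy, hyv⟩ := hV.exists_up hi hv (Nat.lt_succ_self r)
      exact ⟨y, hy, by omega⟩
    · obtain ⟨v, hv, hlt⟩ := h2 h3
      obtain ⟨y, hy, hyv⟩ := hV.exists_up hi hv (Nat.lt_succ_self r)
      exact ⟨y, hy, by omega⟩
  · rintro m _ y hy s ⟨k, rfl, h1, h2⟩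
    unfold posAct
    split_ifs with he
    swap
    · exact ⟨k, rfl, h1, h2⟩
    have lt_of : ∀ l v, V (r, l) = some v → v < y → l < m := by
      intro l v hv hlt
      by_contra hge
      rcases (not_lt.1 hge).eq_or_lt with rfl | h3
      · rw [hy] at hv; cases hv; omega
      · have := hi.row h3 hy hv; omega
    have hkm : k ≤ m := by
      by_cases h3 : 1 ≤ k
      · by_cases h4 : k ≤ j₀
        · obtain ⟨v, hv, hlt⟩ := h1 h3 h4
          have := lt_of _ _ hv (by omega)
          omega
        · obtain ⟨v, hv, hlt⟩ := h2 (by omega)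
          exact (lt_of _ _ hv (by omega)).le
      · omega
    refine ⟨k + 1, by push_cast; omega, fun h3 h4 => ?_, fun h3 => ?_⟩
    · rw [Nat.add_sub_cancel]
      rcases hkm.eq_or_lt with rfl | hlt
      · exact ⟨y, hy, by push_cast; omega⟩
      · obtain ⟨v, hv, hvy⟩ := hV.exists_left hi hy hlt
        exact ⟨v, hv, by push_cast; omega⟩
    · have hkm' : k < m := by
        rcases (show j₀ = k ∨ j₀ < k by omega) with rfl | h4
        · refine lt_of_le_of_ne hkm ?_
          rintro rfl
          exact h r (by rw [hy, he])
        · obtain ⟨v, hv, hlt⟩ := h2 h4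
          exact lt_of _ _ hv (by omega)
      rcases (show k + 1 = m ∨ k + 1 < m by omega) with rfl | h4
      · exact ⟨y, hy, by push_cast; omega⟩
      · obtain ⟨v, hv, hvy⟩ := hV.exists_left hi hy h4
        exact ⟨v, hv, by push_cast; omega⟩

lemma LowerShape.le_apply {V : ℕ × ℕ → Option ℤ} (hV : LowerShape V) (hi : Increasing V)
    (h0 : V (0, 0) = some 1) {i j : ℕ} {v : ℤ} (h : V (i, j) = some v) : (i + j + 1 : ℤ) ≤ v := by
  induction i generalizing v with
  | zero =>
    induction j generalizing v with
    | zero => rw [h0] at h; cases h; simp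
    | succ j ih =>
      obtain ⟨y, hy, hlt⟩ := hV.exists_left hi h (Nat.lt_succ_self j)
      have := ih hy
      push_cast at this ⊢
      omega
  | succ i ih =>
    obtain ⟨y, hy, hlt⟩ := hV.exists_up hi h (Nat.lt_succ_self i)
    have := ih hy
    push_cast at this ⊢
    omega

/-- A rectangular minimal block of full width is determined by the word. -/
lemma WordEquiv.block {V V' : ℕ × ℕ → Option ℤ} (h : WordEquiv V V') (hV : LowerShape V)
    (hi : Increasing V) (hV' : LowerShape V') (hi' : Increasing V') {a b : ℕ}
    (hblock : ∀ i < b, ∀ j < a, V (i, j) = some (i + j + 1 : ℤ))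
    (ha : ∀ k, a ≤ k → V (0, k) = none) :
    ∀ i < b, ∀ j < a, V' (i, j) = some (i + j + 1 : ℤ) := by
  intro i hib j hja
  have h00 : V' (0, 0) = some 1 := by
    rw [h.first_row hV hi hV' hi', hblock 0 (by omega) 0 (by omega)]
    simp
  have ha' : ∀ p, V' p ≠ none → p.2 < a := by
    rintro ⟨r, k⟩ hp
    by_contra hk
    refine hV' (0, k) (r, k) (by simp [Prod.le_def]) hp ?_
    rw [h.first_row hV hi hV' hi', ha k (by simpa using hk)]
  obtain ⟨R, K, hb, hb', he⟩ := h
  have e := he posAct posAct_kknuth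
  have hex : ∀ i < b, ∃ i', V' (i', j) = some (i + j + 1 : ℤ) := by
    intro i hib
    by_contra hne
    push Not at hne
    have hiR : i < R := (hb (i, j) (by simp [hblock i hib j hja])).1
    have haK : a ≤ K := by
      have := (hb (i, a - 1) (by simp [hblock i hib (a - 1) (by omega)])).2
      simp only at this
      omega
    have h1 := le_pos_of_block (V := V) hiR haK (hblock i hib)
    have h2 := pos_lt_of_lacks hV' hi' (R := R) (K := K) ha' hja (i + 1)
      (fun i' => by
        have := hne i'
        rwa [show (i : ℤ) + 1 + j = i + j + 1 by ring])
    rw [e] at h1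
    omega
  induction i using Nat.strong_induction_on with
  | _ i ih =>
    obtain ⟨i', hi1⟩ := hex i hib
    have h1 := hV'.le_apply hi' h00 hi1
    rcases (show i' < i ∨ i' = i by omega) with hlt | rfl
    · rw [ih i' hlt (by omega)] at hi1
      simp only [Option.some.injEq] at hi1
      omega
    · exact hi1

/-- The action of a letter `x` on bit strings, sorting the bits at `x` and `x + 1`. -/
def sortAct (x : ℤ) (s : ℤ → Bool) : ℤ → Bool := fun t =>
  if t = x then s x && s (x + 1) else if t = x + 1 then s x || s (x + 1) else s t

lemma sortAct_self (x : ℤ) (s : ℤ → Bool) : sortAct x s x = (s x && s (x + 1)) := if_pos rfl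

lemma sortAct_succ (x : ℤ) (s : ℤ → Bool) : sortAct x s (x + 1) = (s x || s (x + 1)) := by
  simp [sortAct]

lemma sortAct_of_ne {x t : ℤ} (s : ℤ → Bool) (h : t ≠ x) (h' : t ≠ x + 1) :
    sortAct x s t = s t := by
  simp [sortAct, h, h']

lemma sortAct_idem (x : ℤ) (s : ℤ → Bool) : sortAct x (sortAct x s) = sortAct x s := by
  ext t
  by_cases h : t = x
  · subst h
    simp only [sortAct_self, sortAct_succ]
    cases s t <;> simp
  by_cases h' : t = x + 1
  · subst h'
    simp only [sortAct_self, sortAct_succ]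
    cases s x <;> simp
  · simp only [sortAct_of_ne _ h h']

lemma sortAct_comm {x z : ℤ} (h : x + 2 ≤ z) (s : ℤ → Bool) :
    sortAct x (sortAct z s) = sortAct z (sortAct x s) := by
  ext t
  have h1 : x ≠ z := by omega
  have h2 : x ≠ z + 1 := by omega
  have h3 : x + 1 ≠ z := by omega
  have h4 : x + 1 ≠ z + 1 := by omega
  by_cases e1 : t = x
  · subst e1
    simp only [sortAct_self, sortAct_of_ne _ h1 h2, sortAct_of_ne _ h3 h4]
  by_cases e2 : t = x + 1
  · subst e2
    simp only [sortAct_succ, sortAct_of_ne _ h1 h2, sortAct_of_ne _ h3 h4]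
  rw [sortAct_of_ne _ e1 e2]
  by_cases e3 : t = z
  · subst e3
    simp only [sortAct_self, sortAct_of_ne _ h1.symm h3.symm, sortAct_of_ne _ h2.symm h4.symm]
  by_cases e4 : t = z + 1
  · subst e4
    simp only [sortAct_succ, sortAct_of_ne _ h1.symm h3.symm, sortAct_of_ne _ h2.symm h4.symm]
  · rw [sortAct_of_ne _ e3 e4, sortAct_of_ne _ e3 e4, sortAct_of_ne _ e1 e2]

lemma sortAct_braid (x : ℤ) (s : ℤ → Bool) :
    sortAct x (sortAct (x + 1) (sortAct x s)) =
      sortAct (x + 1) (sortAct x (sortAct (x + 1) s)) := by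
  have e0 : ∀ s, sortAct (x + 1) s x = s x := fun s => sortAct_of_ne s (by omega) (by omega)
  have e1 : ∀ s, sortAct x s (x + 1 + 1) = s (x + 1 + 1) :=
    fun s => sortAct_of_ne s (by omega) (by omega)
  ext t
  by_cases h : t = x
  · subst h
    simp only [e0, e1, sortAct_self, sortAct_succ]
    cases s t <;> cases s (t + 1) <;> simp
  by_cases h' : t = x + 1
  · subst h'
    simp only [e0, e1, sortAct_self, sortAct_succ]
    cases s x <;> cases s (x + 1) <;> simp
  by_cases h'' : t = x + 1 + 1
  · subst h''
    simp only [e0, e1, sortAct_self, sortAct_succ]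
    cases s x <;> cases s (x + 1) <;> simp
  · simp only [sortAct_of_ne _ h h', sortAct_of_ne _ h' h'']

lemma sortAct_kknuth : KKnuthAct sortAct where
  idem := sortAct_idem
  braid x y s := by
    rcases (show y = x ∨ y = x + 1 ∨ x = y + 1 ∨ x + 2 ≤ y ∨ y + 2 ≤ x by omega) with
      rfl | rfl | rfl | h | h
    · rfl
    · exact sortAct_braid x s
    · exact (sortAct_braid y s).symm
    · rw [← sortAct_comm h s, sortAct_idem, ← sortAct_comm h, sortAct_idem, sortAct_comm h]
    · rw [sortAct_comm h s, sortAct_idem, sortAct_comm h, sortAct_idem]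
  left x y z s h h' := by rw [sortAct_comm (x := x) (z := z) (by omega)]
  right x y z s h h' := by rw [sortAct_comm (x := x) (z := z) (by omega)]

/-- Restrict an action to the letters that are at most `v`. -/
def truncAct {X : Type} (g : ℤ → X → X) (v x : ℤ) (s : X) : X := if x ≤ v then g x s else s

lemma KKnuthAct.trunc {X : Type} {g : ℤ → X → X} (hg : KKnuthAct g) (v : ℤ) :
    KKnuthAct (truncAct g v) where
  idem x s := by
    unfold truncAct
    split_ifs <;> simp [hg.idem]
  braid x y s := by
    unfold truncAct
    split_ifs <;> simp [hg.idem, hg.braid x y]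
  left x y z s h h' := by
    unfold truncAct
    split_ifs <;> first | omega | simp [hg.left x y z s h h']
  right x y z s hxy hyz := by
    unfold truncAct
    split_ifs <;> first | omega | simp [hg.right x y z s hxy hyz]

/-- `W` has the minimal entries on a fat hook and is empty to the right of and below it, except
possibly in its corner. -/
structure HookTab (a b c d : ℕ) (W : ℕ × ℕ → Option ℤ) : Prop where
  upper : ∀ i < b, ∀ j < a, W (i, j) = some (i + j + 1 : ℤ)
  upper_none : ∀ i < b, ∀ j, a ≤ j → W (i, j) = none
  lower : ∀ i, b ≤ i → i < b + d → ∀ j < c, W (i, j) = some (i + j + 1 : ℤ)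
  lower_none : ∀ i j, b + d ≤ i → W (i, j) = none

lemma truncAct_sortAct_of_ne {v x t : ℤ} (s : ℤ → Bool) (h : t ≠ x) (h' : t ≠ x + 1) :
    truncAct sortAct v x s t = s t := by
  unfold truncAct
  split_ifs
  · exact sortAct_of_ne s h h'
  · rfl

lemma truncAct_sortAct_of_false {v x : ℤ} {s : ℤ → Bool} (h : s x = false)
    (h' : s (x + 1) = false) : truncAct sortAct v x s = s := by
  unfold truncAct
  split_ifs
  · ext t
    by_cases h1 : t = x
    · rw [h1, sortAct_self, h]
      rfl
    by_cases h2 : t = x + 1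
    · rw [h2, sortAct_succ, h, h']
      rfl
    · rw [sortAct_of_ne s h1 h2]
  · rfl

section Bits

variable {a b c d R K k : ℕ} {W : ℕ × ℕ → Option ℤ} {v : ℤ}

/-- The bits at `1, …, b` are set, and the particle starting at `k` has reached `v` once row
`k - 1` has acted. -/
def LowerBits (b k : ℕ) (v : ℤ) (n : ℕ) (s : ℤ → Bool) : Prop :=
  (∀ t : ℤ, 1 ≤ t → t ≤ b → s t = true) ∧ (n < k → s v = true ∧ s (v + 1) = false) ∧
    (k ≤ n → s k = true ∧ ∀ t : ℤ, k < t → s t = false)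

lemma lowerBits_init (hk : b + 1 ≤ k) (hv : (k : ℤ) ≤ v) (n : ℕ) :
    ∃ s, LowerBits b k v n s := by
  refine ⟨fun t => decide ((1 ≤ t ∧ t ≤ b) ∨ t = if n < k then v else k), ?_, ?_, ?_⟩
  · intro t h1 h2
    simp [h1, h2]
  · intro h
    simp [h]
    omega
  · intro h
    simp [h.not_gt]
    intro t ht
    omega

lemma HookTab.lowerBits_step (hW : HookTab a b c d W) (hk : b + 1 ≤ k) (hv : v = k + c) {n : ℕ}
    (hbn : b ≤ n) (hn : n < b + d) {s : ℤ → Bool} (hs : LowerBits b k v (n + 1) s) :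
    LowerBits b k v n (rowAct (truncAct sortAct v) W n c s) := by
  obtain ⟨h1, h2, h3⟩ := hs
  refine ⟨fun t ht ht' => ?_, fun hnk => ?_, fun hnk => ?_⟩
  · refine rowAct_induct (fun _ (s : ℤ → Bool) => s t = true) (h1 t ht ht') fun j hj s hs => ?_
    rw [hW.lower n hbn hn j hj, optAct_some, truncAct_sortAct_of_ne s (by omega) (by omega), hs]
  · rcases (show n + 1 < k ∨ n + 1 = k by omega) with h | rfl
    · refine rowAct_induct (fun _ (s : ℤ → Bool) => s v = true ∧ s (v + 1) = false)
        (h2 h) fun j hj s hs => ?_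
      rw [hW.lower n hbn hn j hj, optAct_some, truncAct_sortAct_of_ne s (by omega) (by omega),
        truncAct_sortAct_of_ne s (by omega) (by omega)]
      exact hs
    · have := rowAct_induct (g := truncAct sortAct v) (V := W) (i := n) (m := c)
        (fun j s => s (n + 1 + j) = true ∧ ∀ t : ℤ, n + 1 + j < t → s t = false) (s := s)
        (by simpa using h3 le_rfl) fun j hj s hs => by
          rw [hW.lower n hbn hn j hj, optAct_some]
          obtain ⟨e1, e2⟩ := hs
          have e3 := e2 (n + 1 + j + 1) (by omega)
          have e4 : (n : ℤ) + j + 1 = n + 1 + j := by ring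
          rw [e4]
          unfold truncAct
          rw [if_pos (by push_cast at hv; omega)]
          unfold sortAct
          push_cast
          refine ⟨by simp [← add_assoc, e1], fun t ht => ?_⟩
          rw [if_neg (by omega), if_neg (by omega)]
          exact e2 t (by omega)
      have hv' : v = n + 1 + c := by
        rw [hv]
        push_cast
        ring
      generalize rowAct (truncAct sortAct v) W n c s = s' at this
      subst hv'
      exact ⟨this.1, this.2 _ (by omega)⟩
  · refine rowAct_induct (fun _ (s : ℤ → Bool) => s k = true ∧ ∀ t : ℤ, k < t → s t = false)
      (h3 (by omega)) fun j hj s hs => ?_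
    rw [hW.lower n hbn hn j hj, optAct_some]
    obtain ⟨e1, e2⟩ := hs
    rw [truncAct_sortAct_of_false (e2 _ (by omega)) (e2 _ (by omega))]
    exact ⟨e1, e2⟩

lemma rowAct_trunc_eq {X : Type} {g : ℤ → X → X} {n m : ℕ} (hcm : c ≤ m)
    (h : ∀ j, c ≤ j → ∀ x, W (n, j) = some x → v < x) (s : X) :
    rowAct (truncAct g v) W n m s = rowAct (truncAct g v) W n c s := by
  refine rowAct_induct_le (fun _ t => t = _) hcm rfl fun j hj _ t ht => ?_
  rcases hx : W (n, j) with _ | x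
  · exact ht
  · rw [optAct_some, truncAct, if_neg (h j hj x hx).not_ge, ht]

/-- The state of a bit after a minimal row `i` of length `a` has acted, provided the bit at
`i + 1` is set. -/
lemma HookTab.upper_shift (hW : HookTab a b c d W) {i : ℕ} (hi : i < b) {s : ℤ → Bool}
    (h1 : s (i + 1) = true) (t : ℤ) :
    (t ≤ i → rowAct (truncAct sortAct v) W i a s t = s t) ∧
    (i + 1 ≤ t → t ≤ i + a → t ≤ v →
      rowAct (truncAct sortAct v) W i a s t = s (t + 1)) := by
  have := rowAct_induct (g := truncAct sortAct v) (V := W) (i := i) (m := a)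
    (fun m s' => ((i + m + 1 : ℤ) ≤ v + 1 → s' (i + m + 1) = true ∧
        (∀ t : ℤ, i + m + 1 < t → s' t = s t)) ∧ (∀ t : ℤ, t ≤ i → s' t = s t) ∧
        (∀ t : ℤ, i + 1 ≤ t → t ≤ i + m → t ≤ v → s' t = s (t + 1))) (s := s)
    ⟨by simp [h1], by simp, by intros; omega⟩ fun j hj s' hs => by
      rw [hW.upper i hi j hj, optAct_some]
      obtain ⟨e1, e2, e3⟩ := hs
      unfold truncAct
      split_ifs with hle
      · obtain ⟨e4, e5⟩ := e1 (by omega)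
        have e6 := e5 (i + j + 1 + 1) (by omega)
        unfold sortAct
        push_cast
        refine ⟨fun _ => ⟨?_, fun t ht => ?_⟩, fun t ht => ?_, fun t ht ht' htv => ?_⟩
        · rw [if_neg (by omega), if_pos (by ring), e4]
          simp
        · rw [if_neg (by omega), if_neg (by omega)]
          exact e5 t (by omega)
        · rw [if_neg (by omega), if_neg (by omega)]
          exact e2 t ht
        · rcases (show t = i + j + 1 ∨ t ≤ i + j by omega) with rfl | h
          · rw [if_pos rfl, e4, e6]
            simp
          · rw [if_neg (by omega), if_neg (by omega)]
            exact e3 t ht h htv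
      · refine ⟨fun h => ?_, e2, fun t ht ht' htv => e3 t ht (by omega) htv⟩
        push_cast at h
        omega
  exact ⟨this.2.1 t, this.2.2 t⟩

/-- A K-Knuth action reads off whether the corner of a fat hook contains the value `v`. -/
lemma HookTab.corner_eq (hW : HookTab a b c d W) (hb : BoundedBy W R K) (hd : 0 < d)
    (hk : b + 1 ≤ k) (hv : v = k + c)
    (hc : ∀ i j x, b ≤ i → c ≤ j → W (i, j) = some x → v < x ∨ (i = b ∧ j = c ∧ x = v))
    {s : ℤ → Bool} (hs : LowerBits b k v (b + d) s) :
    tabAct (truncAct sortAct v) W K R s (if (a + b : ℤ) ≤ v then v + 1 else v - b + 1) =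
      decide (W (b, c) = some v) := by
  have hRR : tabAct (truncAct sortAct v) W K R s =
      tabAct (truncAct sortAct v) W K (b + d) s := by
    rcases le_total (b + d) R with h | h
    · exact tabAct_eq_of_le h hW.lower_none s
    · refine (tabAct_eq_of_le h (fun i j hi => ?_) s).symm
      by_contra hne
      exact absurd (hb (i, j) hne).1 (by simpa using hi)
  have hcK : c ≤ K := by
    by_contra h
    have := (hb (b, K) (by simp [hW.lower b le_rfl (by omega) K (by omega)])).2
    simp at this
  rw [hRR]
  have key := tabAct_induct (g := truncAct sortAct v) (V := W) (K := K) (n := b + d) (s := s)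
    (fun r s => (∀ t : ℤ, 1 ≤ t → t ≤ r → t ≤ b → s t = true) ∧
      (b < r → LowerBits b k v r s) ∧
      (r ≤ b → s (if (a + b : ℤ) ≤ v then v + 1 else v - b + r + 1) =
        decide (W (b, c) = some v)))
    ⟨fun t h1 _ h2 => hs.1 t h1 h2, fun _ => hs, by omega⟩ ?_
  · have := key.2.2 (Nat.zero_le _)
    simpa using this
  rintro i hi s ⟨h1, h2, h3⟩
  rcases lt_trichotomy b i with hbi | rfl | hib
  · rw [rowAct_trunc_eq hcK fun j hj x hx =>
      (hc i j x hbi.le hj hx).resolve_right (by omega)]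
    have := hW.lowerBits_step hk hv hbi.le hi (h2 (by omega))
    exact ⟨fun t ht _ ht' => this.1 t ht ht', fun _ => this, by omega⟩
  · have hL := hW.lowerBits_step hk hv le_rfl hi (h2 (by omega))
    have hvc : (if (a + b : ℤ) ≤ v then v + 1 else v - b + b + 1) = v + 1 := by
      split_ifs <;> ring
    have hbv : (b : ℤ) < v := by omega
    rw [hvc]
    obtain ⟨l1, l2, -⟩ := hL
    obtain ⟨l2, l3⟩ := l2 (by omega)
    by_cases hcor : W (b, c) = some v
    · have hcK' : c + 1 ≤ K := (hb (b, c) (by simp [hcor])).2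
      rw [rowAct_trunc_eq hcK' fun j hj x hx =>
        (hc b j x le_rfl (by omega) hx).resolve_right (by omega), rowAct, hcor, optAct_some,
        truncAct, if_pos le_rfl]
      refine ⟨fun t ht _ ht' => ?_, by omega, fun _ => ?_⟩
      · simp only [sortAct]
        rw [if_neg (by omega), if_neg (by omega)]
        exact l1 t ht ht'
      · simp [sortAct, l2]
    · rw [rowAct_trunc_eq hcK fun j hj x hx => (hc b j x le_rfl hj hx).resolve_right (by
        rintro ⟨-, rfl, rfl⟩
        exact hcor hx)]
      exact ⟨fun t ht _ ht' => l1 t ht ht', by omega, fun _ => by simp [l3, hcor]⟩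
  · have haK : a ≤ K := by
      by_contra h
      have := (hb (i, K) (by simp [hW.upper i hib K (by omega)])).2
      simp at this
    rw [rowAct_trunc_eq haK fun j hj x hx => by
      rw [hW.upper_none i hib j hj] at hx
      cases hx]
    have hsh := hW.upper_shift hib (v := v) (h1 (i + 1) (by omega) (by push_cast; omega) (by omega))
    refine ⟨fun t ht ht' hb => ?_, by omega, fun _ => ?_⟩
    · rw [(hsh t).1 ht']
      exact h1 t ht (by push_cast; omega) hb
    · rw [← h3 (by omega)]
      split_ifs with hav
      · refine rowAct_induct (fun _ (s' : ℤ → Bool) => s' (v + 1) = s (v + 1)) rfl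
          fun j hj s' hs' => ?_
        rw [hW.upper i hib j hj, optAct_some, truncAct_sortAct_of_ne s' (by omega) (by omega), hs']
      · rw [(hsh _).2 (by omega) (by omega) (by omega)]
        push_cast
        congr 1
        ring

end Bits

/-- Word-equivalent tableaux agreeing with the minimal tableau on a fat hook have the same corner
entry if the corner entry of one of them is minimal. -/
lemma WordEquiv.corner_ne {a b c d : ℕ} {V V' : ℕ × ℕ → Option ℤ} (h : WordEquiv V V')
    (hV : HookTab a b c d V) (hV' : HookTab a b c d V') {v : ℤ} (hd : 0 < d)
    (hv : (b + c + 1 : ℤ) ≤ v)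
    (hlt : ∀ i j x, b ≤ i → c ≤ j → V (i, j) = some x → v < x)
    (hlt' : ∀ i j x, b ≤ i → c ≤ j → V' (i, j) = some x → v < x ∨ (i = b ∧ j = c ∧ x = v)) :
    V' (b, c) ≠ some v := by
  obtain ⟨k, hk⟩ : ∃ k : ℕ, v = k + c := ⟨(v - c).toNat, by omega⟩
  obtain ⟨R, K, hb, hb', he⟩ := h
  obtain ⟨s, hs⟩ := lowerBits_init (b := b) (k := k) (v := v) (by omega) (by omega) (b + d)
  have e1 := hV.corner_eq hb hd (by omega) hk (fun i j x h1 h2 h3 => .inl (hlt i j x h1 h2 h3)) hs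
  have e2 := hV'.corner_eq hb' hd (by omega) hk hlt' hs
  rw [he _ (sortAct_kknuth.trunc v), e2] at e1
  intro hcor
  have : V (b, c) = some v := by simpa [hcor] using e1
  exact lt_irrefl _ (hlt b c v le_rfl le_rfl this)

section OrderIso

variable {L : Type} [PartialOrder L] (e : L ≃o L)

lemma swapVal_comp {V : Type} (s s' : V) (T : L → Option V) :
    swapVal s s' (T ∘ e) = swapVal s s' T ∘ e := by
  have key : ∀ α (u : V), (∃ β, Neighbor (e α) β ∧ T β = some u) ↔
      ∃ β, Neighbor α β ∧ T (e β) = some u := fun α u => by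
    rw [e.surjective.exists]
    simp only [Neighbor, apply_covBy_apply_iff]
  funext α
  simp only [swapVal, Function.comp_apply, key]

lemma swapUp_comp (a : ℤ) (n : ℕ) (T : L → Option ZDot) :
    swapUp a n (T ∘ e) = swapUp a n T ∘ e := by
  induction n with
  | zero => rfl
  | succ n ih => rw [swapUp, ih, swapVal_comp, swapUp]

lemma mem_image_symm {C : Finset L} {p : L} : p ∈ C.image e.symm ↔ e p ∈ C := by
  rw [Finset.mem_image]
  exact ⟨by rintro ⟨q, hq, rfl⟩; simpa using hq, fun h => ⟨e p, h, by simp⟩⟩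

lemma StraightShape.image_symm {lam : Finset L} (h : StraightShape lam) :
    StraightShape (lam.image e.symm) := fun a ha b hb => by
  rw [mem_image_symm] at ha ⊢
  exact h _ ha _ (e.monotone hb)

lemma IsForwardSlide.comp {T T' : L → Option ℤ} (h : IsForwardSlide T T') :
    IsForwardSlide (T ∘ e) (T' ∘ e) := by
  obtain ⟨lam, nu, C, a, b, ⟨h1, h2, h3⟩, h4, h5, h6, rfl⟩ := h
  refine ⟨lam.image e.symm, nu.image e.symm, C.image e.symm, a, b,
    ⟨h1.image_symm e, h2.image_symm e, Finset.image_subset_image h3⟩, ?_, fun α => h5 (e α),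
    fun c hc => ?_, ?_⟩
  · ext p
    have := Set.ext_iff.1 h4 (e p)
    simp only [Set.mem_sdiff, Finset.mem_coe, mem_image_symm] at this ⊢
    exact this
  · rw [mem_image_symm] at hc ⊢
    refine ⟨(h6 _ hc).1, fun d hd hlt => ?_⟩
    rw [mem_image_symm] at hd
    exact (h6 _ hc).2 _ hd (e.strictMono hlt)
  · have : addDots (C.image e.symm) (toDotted (T ∘ e)) = addDots C (toDotted T) ∘ e := by
      funext p
      simp only [addDots, toDotted, mem_image_symm, Function.comp_apply]
    rw [this, swapUp_comp]
    rfl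

end OrderIso

/-- The transposed tableau. -/
def transposed (T : ℕ × ℕ → Option ℤ) : ℕ × ℕ → Option ℤ := fun p => T p.swap

lemma IsForwardSlide.transposed {T T' : ℕ × ℕ → Option ℤ} (h : IsForwardSlide T T') :
    IsForwardSlide (transposed T) (transposed T') := 
  h.comp (OrderIso.prodComm : ℕ × ℕ ≃o ℕ × ℕ)

lemma slides_transposed {T T' : ℕ × ℕ → Option ℤ}
    (h : Relation.ReflTransGen IsForwardSlide T T') :
    Relation.ReflTransGen IsForwardSlide (transposed T) (transposed T') := by
  induction h with
  | refl => exact .refl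
  | tail _ h ih => exact ih.tail h.transposed

lemma Increasing.transposed {T : ℕ × ℕ → Option ℤ} (h : Increasing T) :
    Increasing (transposed T) := fun a b hab x y hx hy =>
  h a.swap b.swap (Prod.swap_lt_swap.2 hab) x y hx hy

lemma LowerShape.transposed {T : ℕ × ℕ → Option ℤ} (h : LowerShape T) :
    LowerShape (transposed T) := fun p q hpq hq =>
  h p.swap q.swap (Prod.swap_le_swap.2 hpq) hq

lemma BoundedBy.transposed {T : ℕ × ℕ → Option ℤ} {R K : ℕ} (h : BoundedBy T R K) :
    BoundedBy (transposed T) K R := fun p hp => (h p.swap hp).symm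

/-- The part of `T` with values larger than `N`. -/
def above (N : ℤ) (T : ℕ × ℕ → Option ℤ) : ℕ × ℕ → Option ℤ := fun p =>
  (T p).filter fun v => N < v

lemma above_eq_some {N : ℤ} {T : ℕ × ℕ → Option ℤ} {p : ℕ × ℕ} {v : ℤ} :
    above N T p = some v ↔ T p = some v ∧ N < v := by
  simp [above, Option.filter_eq_some_iff]

lemma above_eq_none {N : ℤ} {T : ℕ × ℕ → Option ℤ} {p : ℕ × ℕ} :
    above N T p = none ↔ ∀ v, T p = some v → v ≤ N := by
  simp [above, Option.filter_eq_none_iff]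

lemma Increasing.above {T : ℕ × ℕ → Option ℤ} (h : Increasing T) (N : ℤ) :
    Increasing (above N T) := fun a b hab x y hx hy =>
  h a b hab x y (above_eq_some.1 hx).1 (above_eq_some.1 hy).1

lemma nextVal_above {N : ℤ} {T : ℕ × ℕ → Option ℤ} {i j : ℕ}
    (h : ∀ w, nextVal T i j = some w → N < w) : nextVal (above N T) i j = nextVal T i j := by
  have key : ∀ p, (p = (i, j + 1) ∨ p = (i + 1, j)) → above N T p = T p := by
    intro p hp
    rcases hv : T p with _ | v
    · exact above_eq_none.2 fun v h' => by rw [hv] at h'; cases h'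
    · refine above_eq_some.2 ⟨hv, ?_⟩
      rcases hn : nextVal T i j with _ | w
      · rw [nextVal_eq_none] at hn
        rcases hp with rfl | rfl
        · rw [hn.1] at hv; cases hv
        · rw [hn.2] at hv; cases hv
      · have h1 := h w hn
        rw [nextVal_eq_some] at hn
        rcases hp with rfl | rfl
        · exact h1.trans_le (hn.2.1 v hv)
        · exact h1.trans_le (hn.2.2 v hv)
  unfold nextVal
  rw [key _ (.inl rfl), key _ (.inr rfl)]

namespace SlideSite

variable {lam nu C : Finset (ℕ × ℕ)} {T : ℕ × ℕ → Option ℤ}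

/-- The boxes of the outer shape at which the part of `T` above `N` is undefined. -/
def lowBoxes (nu : Finset (ℕ × ℕ)) (N : ℤ) (T : ℕ × ℕ → Option ℤ) : Finset (ℕ × ℕ) :=
  nu.filter fun p => above N T p = none

/-- The starting boxes of the slide induced on the part of `T` above `N`. -/
def aboveStart (nu C : Finset (ℕ × ℕ)) (N : ℤ) (T : ℕ × ℕ → Option ℤ) : Finset (ℕ × ℕ) :=
  (lowBoxes nu N T).filter fun p =>
    Affected T C p.1 p.2 ∧ ∀ w, nextVal T p.1 p.2 = some w → N < w

lemma mem_lowBoxes {N : ℤ} {p : ℕ × ℕ} :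
    p ∈ lowBoxes nu N T ↔ p ∈ nu ∧ above N T p = none := Finset.mem_filter

lemma mem_aboveStart {N : ℤ} {p : ℕ × ℕ} : p ∈ aboveStart nu C N T ↔
    p ∈ lowBoxes nu N T ∧ Affected T C p.1 p.2 ∧ ∀ w, nextVal T p.1 p.2 = some w → N < w :=
  Finset.mem_filter

lemma isSkewPair_lowBoxes (hs : SlideSite lam nu C T) (hT : Increasing T) (N : ℤ) :
    IsSkewPair (lowBoxes nu N T) nu := by
  refine ⟨fun q hq p hpq => ?_, hs.pair.2.1, Finset.filter_subset _ _⟩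
  rw [mem_lowBoxes] at hq ⊢
  refine ⟨hs.pair.2.1 q hq.1 p hpq, above_eq_none.2 fun v hv => ?_⟩
  rcases hpq.eq_or_lt with rfl | hlt
  · exact above_eq_none.1 hq.2 v hv
  have hq' : T q ≠ none := (hs.shape q).2 ⟨hq.1, fun h => by
    rw [hs.none_of_le_lam h hpq] at hv; cases hv⟩
  obtain ⟨w, hw⟩ := Option.ne_none_iff_exists'.1 hq'
  exact (hT p q hlt v w hv hw).le.trans (above_eq_none.1 hq.2 w hw)

lemma shape_above (hs : SlideSite lam nu C T) (N : ℤ) (p : ℕ × ℕ) :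
    above N T p ≠ none ↔ p ∈ nu ∧ p ∉ lowBoxes nu N T := by
  rw [mem_lowBoxes]
  refine ⟨fun h => ⟨?_, fun h' => h h'.2⟩, fun h h' => h.2 ⟨h.1, h'⟩⟩
  refine ((hs.shape p).1 fun h' => h (above_eq_none.2 fun v hv => ?_)).1
  rw [h'] at hv; cases hv

lemma above_site (hs : SlideSite lam nu C T) (hT : Increasing T) (N : ℤ) :
    SlideSite (lowBoxes nu N T) nu (aboveStart nu C N T) (above N T) where
  pair := hs.isSkewPair_lowBoxes hT N
  shape := hs.shape_above N
  mem c hc := (mem_aboveStart.1 hc).1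
  max c hc d hd hcd := by
    obtain ⟨-, hc2, hc3⟩ := mem_aboveStart.1 hc
    obtain ⟨hd1, hd2⟩ := mem_lowBoxes.1 hd
    have hcT : c ∈ C ∨ T c ≠ none :=
      hc2.mem_or.imp_right fun ⟨v, hv⟩ => by
        rw [show c = (c.1, c.2) from rfl, hv]; simp
    have hdT : T d ≠ none := by
      refine (hs.shape d).2 ⟨hd1, fun hdl => ?_⟩
      rcases hcT with h | h
      · exact hs.max c h d hdl hcd
      · exact h (hs.none_of_le_lam hdl hcd.le)
    obtain ⟨w, hw⟩ := Option.ne_none_iff_exists'.1 hdT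
    have hwN := above_eq_none.1 hd2 w hw
    have key : ∀ e, (e = (c.1, c.2 + 1) ∨ e = (c.1 + 1, c.2)) → c < e → e ≤ d → False := by
      intro e he hce hed
      obtain ⟨u, hu⟩ := Option.ne_none_iff_exists'.1 (hs.ne_none_of_between hcT hce hed hdT)
      have huw : u ≤ w := by
        rcases hed.eq_or_lt with rfl | h
        · rw [hu] at hw; cases hw; rfl
        · exact (hT e d h u w hu hw).le
      rcases hn : nextVal T c.1 c.2 with _ | x
      · rw [nextVal_eq_none] at hn
        rcases he with rfl | rfl
        · rw [hn.1] at hu; cases hu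
        · rw [hn.2] at hu; cases hu
      · have h1 := hc3 x hn
        rw [nextVal_eq_some] at hn
        rcases he with rfl | rfl
        · have := hn.2.1 u hu
          omega
        · have := hn.2.2 u hu
          omega
    obtain ⟨i, j⟩ := c
    obtain ⟨k, l⟩ := d
    rw [Prod.mk_lt_mk] at hcd
    rcases hcd with ⟨h1, h2⟩ | ⟨h1, h2⟩
    · exact key (i + 1, j) (.inr rfl) (by simp [Prod.mk_lt_mk]) (by simp [Prod.le_def]; omega)
    · exact key (i, j + 1) (.inl rfl) (by simp [Prod.mk_lt_mk]) (by simp [Prod.le_def]; omega)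

lemma lt_nextVal_of_affected_above (hT : Increasing T) {N : ℤ} {i j : ℕ}
    (h : Affected (above N T) (aboveStart nu C N T) i j) {w : ℤ}
    (hw : nextVal T i j = some w) : N < w := by
  rcases h.mem_or with h | ⟨v, hv⟩
  · exact (mem_aboveStart.1 h).2.2 w hw
  · rw [above_eq_some] at hv
    exact hv.2.trans (le_nextVal_lt hT hv.1 hw)

lemma affected_of_affected_above (hT : Increasing T) {N : ℤ} {i j : ℕ}
    (h : Affected (above N T) (aboveStart nu C N T) i j) : Affected T C i j := by
  induction h with
  | dot h => exact (mem_aboveStart.1 h).2.1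
  | right h hv hn ih =>
    rw [nextVal_above fun w => lt_nextVal_of_affected_above hT h] at hn
    exact .right ih (above_eq_some.1 hv).1 hn
  | down h hv hn ih =>
    rw [nextVal_above fun w => lt_nextVal_of_affected_above hT h] at hn
    exact .down ih (above_eq_some.1 hv).1 hn

lemma affected_above_of_affected (hs : SlideSite lam nu C T) {N : ℤ} {i j : ℕ}
    (h : Affected T C i j) (h' : (i, j) ∈ aboveStart nu C N T ∨ above N T (i, j) ≠ none) :
    Affected (above N T) (aboveStart nu C N T) i j := by
  have start : ∀ {i j w}, Affected T C i j → nextVal T i j = some w → N < w →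
      (i, j) ∈ aboveStart nu C N T ∨ above N T (i, j) ≠ none := by
    intro i j w ha hw hlt
    by_cases hn : above N T (i, j) = none
    · refine .inl (mem_aboveStart.2 ⟨mem_lowBoxes.2 ⟨?_, hn⟩, ha, fun x hx => ?_⟩)
      · rcases ha.mem_or with h | ⟨v, hv⟩
        · exact hs.pair.2.2 (hs.mem _ h)
        · exact ((hs.shape _).1 (by rw [hv]; simp)).1
      · rw [hw] at hx; cases hx; exact hlt
    · exact .inr hn
  induction h with
  | dot h =>
    refine .dot (h'.resolve_right fun hne => hne ?_)
    exact above_eq_none.2 fun v hv => by rw [hs.none_of_le h le_rfl] at hv; cases hv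
  | right h hv hn ih =>
    rcases h' with h' | h'
    · exact .dot h'
    obtain ⟨u, hu⟩ := Option.ne_none_iff_exists'.1 h'
    obtain ⟨hu1, hu2⟩ := above_eq_some.1 hu
    rw [hv] at hu1; cases hu1
    refine .right (ih (start h hn hu2)) hu ?_
    rwa [nextVal_above fun w hw => by rw [hn] at hw; cases hw; exact hu2]
  | down h hv hn ih =>
    rcases h' with h' | h'
    · exact .dot h'
    obtain ⟨u, hu⟩ := Option.ne_none_iff_exists'.1 h'
    obtain ⟨hu1, hu2⟩ := above_eq_some.1 hu
    rw [hv] at hu1; cases hu1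
    refine .down (ih (start h hn hu2)) hu ?_
    rwa [nextVal_above fun w hw => by rw [hn] at hw; cases hw; exact hu2]

lemma slide_above (hs : SlideSite lam nu C T) (hT : Increasing T) (N : ℤ) :
    slide (above N T) (aboveStart nu C N T) = above N (slide T C) := by
  funext ⟨i, j⟩
  by_cases h' : Affected (above N T) (aboveStart nu C N T) i j
  · have h := affected_of_affected_above hT h'
    have hlt := fun w => lt_nextVal_of_affected_above (w := w) hT h'
    rw [slide_of_affected h', nextVal_above hlt]
    change _ = Option.filter _ (slide T C (i, j))
    rw [slide_of_affected h]
    rcases hn : nextVal T i j with _ | w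
    · rfl
    · simp [Option.filter, hlt w hn]
  · rw [slide_of_not_affected h']
    change Option.filter _ (T (i, j)) = Option.filter _ (slide T C (i, j))
    by_cases h : Affected T C i j
    · have hno : ¬ ((i, j) ∈ aboveStart nu C N T ∨ above N T (i, j) ≠ none) :=
        fun hh => h' (hs.affected_above_of_affected h hh)
      push Not at hno
      obtain ⟨h1, h2⟩ := hno
      rw [slide_of_affected h]
      change above N T (i, j) = _
      rw [h2]
      rcases hn : nextVal T i j with _ | w
      · rfl
      · have : ¬ N < w := fun hlt => h1 <| mem_aboveStart.2 ⟨mem_lowBoxes.2 ⟨?_, h2⟩, h,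
          fun x hx => by rw [hn] at hx; cases hx; exact hlt⟩
        · simp [Option.filter, this]
        · rcases h.mem_or with h | ⟨v, hv⟩
          · exact hs.pair.2.2 (hs.mem _ h)
          · exact ((hs.shape _).1 (by rw [hv]; simp)).1
    · rw [slide_of_not_affected h]

end SlideSite

lemma IsForwardSlide.above {T T' : ℕ × ℕ → Option ℤ} (h : IsForwardSlide T T')
    (hT : Increasing T) (N : ℤ) : IsForwardSlide (above N T) (above N T') := by
  obtain ⟨lam, nu, C, hs, rfl⟩ := h.exists_site hT
  rw [← hs.slide_above hT N]
  exact (hs.above_site hT N).isForwardSlide (hT.above N)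

lemma slides_above {T T' : ℕ × ℕ → Option ℤ} (h : Relation.ReflTransGen IsForwardSlide T T')
    (hT : Increasing T) (N : ℤ) :
    Relation.ReflTransGen IsForwardSlide (above N T) (above N T') := by
  induction h using Relation.ReflTransGen.head_induction_on with
  | refl => exact .refl
  | head h _ ih => exact (Relation.ReflTransGen.single (h.above hT N)).trans (ih (h.increasing hT))

lemma HasSkewShape.above {T : ℕ × ℕ → Option ℤ} (h : IncreasingSkewTableau T) (N : ℤ) :
    HasSkewShape (above N T) := by
  obtain ⟨⟨lam, nu, hp, hsh⟩, hT⟩ := h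
  have hs : SlideSite lam nu ∅ T :=
    ⟨hp, fun p => by simpa [shapeOf] using Set.ext_iff.1 hsh p, by simp, by simp⟩
  refine ⟨_, nu, hs.isSkewPair_lowBoxes hT N, ?_⟩
  ext p
  simpa [shapeOf] using hs.shape_above N p

/-- The tableau `X` moved down by `b` rows, with its `i`-th row moved to the right by `o i`. -/
def displaced (b : ℕ) (o : ℕ → ℕ) (X : ℕ × ℕ → Option ℤ) : ℕ × ℕ → Option ℤ := fun p =>
  if b ≤ p.1 ∧ o (p.1 - b) ≤ p.2 then X (p.1 - b, p.2 - o (p.1 - b)) else none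

section Displaced

variable {X : ℕ × ℕ → Option ℤ} {b H W : ℕ} {o : ℕ → ℕ}

lemma displaced_add {i j : ℕ} : displaced b o X (b + i, o i + j) = X (i, j) := by
  simp [displaced]

lemma exists_of_displaced_ne_none {p : ℕ × ℕ} (h : displaced b o X p ≠ none) :
    ∃ i j, p = (b + i, o i + j) := by
  obtain ⟨k, l⟩ := p
  by_cases h' : b ≤ k ∧ o (k - b) ≤ l
  · refine ⟨k - b, l - o (k - b), ?_⟩
    rw [Nat.add_sub_cancel' h'.1, Nat.add_sub_cancel' h'.2]
  · simp [displaced, h'] at h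

lemma Increasing.displaced (hX : Increasing X) (ho : Antitone o) :
    Increasing (displaced b o X) := by
  intro p q hpq x y hx hy
  obtain ⟨i, j, rfl⟩ := exists_of_displaced_ne_none (p := p) (by rw [hx]; simp)
  obtain ⟨k, l, rfl⟩ := exists_of_displaced_ne_none (p := q) (by rw [hy]; simp)
  rw [displaced_add] at hx hy
  refine hX _ _ ?_ _ _ hx hy
  rw [Prod.mk_lt_mk] at hpq ⊢
  have hik : i ≤ k := by omega
  have := ho hik
  rcases hik.eq_or_lt with rfl | h
  · omega
  · exact .inl ⟨h, by omega⟩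

/-- The boxes not to the right of a displaced tableau. -/
def displacedInner (b H W : ℕ) (o : ℕ → ℕ) : Finset (ℕ × ℕ) :=
  (Finset.range (b + H) ×ˢ Finset.range (W + o 0)).filter fun p => p.1 < b ∨ p.2 < o (p.1 - b)

lemma displaced_site (hL : LowerShape X) (hb : BoundedBy X H W) (ho : Antitone o)
    (hH : ∀ i, H ≤ i → o i = 0) {r e : ℕ} (hr : o r = e + 1) (hr' : ∀ i, r < i → o i = 0) :
    ∃ nu, SlideSite (displacedInner b H W o) nu {(b + r, e)} (displaced b o X) := by
  have hrH : r < H := by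
    by_contra h
    have := hH r (by omega)
    omega
  have hnot : ∀ p, displaced b o X p ≠ none → p ∉ displacedInner b H W o := by
    intro p hp
    obtain ⟨i, j, rfl⟩ := exists_of_displaced_ne_none hp
    simp [displacedInner]
  refine ⟨(Finset.range (b + H) ×ˢ Finset.range (W + o 0)).filter fun p =>
    p ∈ displacedInner b H W o ∨ displaced b o X p ≠ none, ⟨⟨?_, ?_, ?_⟩, fun p => ?_, ?_, ?_⟩⟩
  · rintro ⟨i, j⟩ hp ⟨k, l⟩ hq
    simp only [displacedInner, Finset.mem_filter, Finset.mem_product, Finset.mem_range,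
      Prod.mk_le_mk] at hp hq ⊢
    have := ho (Nat.sub_le_sub_right hq.1 b)
    omega
  · rintro ⟨i, j⟩ hp ⟨k, l⟩ hq
    simp only [displacedInner, Finset.mem_filter, Finset.mem_product, Finset.mem_range,
      Prod.mk_le_mk] at hp hq ⊢
    have := ho (Nat.sub_le_sub_right hq.1 b)
    obtain ⟨hp1, hp2⟩ := hp
    refine ⟨by omega, ?_⟩
    by_cases hk : k < b ∨ l < o (k - b)
    · exact .inl ⟨by omega, hk⟩
    · right
      have hd : displaced b o X (i, j) ≠ none := hp2.resolve_left fun h => hk (by omega)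
      obtain ⟨i, j, hij⟩ := exists_of_displaced_ne_none hd
      obtain ⟨rfl, rfl⟩ := Prod.mk.inj hij
      rw [displaced_add] at hd
      have h1 : displaced b o X (k, l) = X (k - b, l - o (k - b)) := by
        simp only [displaced]
        rw [if_pos (by omega)]
      rw [h1]
      refine hL _ (i, j) ?_ hd
      rw [Nat.add_sub_cancel_left] at this
      rw [Prod.mk_le_mk]
      omega
  · intro p hp
    refine Finset.mem_filter.2 ⟨(Finset.mem_filter.1 hp).1, .inl hp⟩
  · refine ⟨fun hp => ⟨Finset.mem_filter.2 ⟨?_, .inr hp⟩, hnot p hp⟩, fun hp =>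
      ((Finset.mem_filter.1 hp.1).2).resolve_left hp.2⟩
    obtain ⟨i, j, rfl⟩ := exists_of_displaced_ne_none hp
    rw [displaced_add] at hp
    have := hb _ hp
    have := ho (Nat.zero_le i)
    simp only [Finset.mem_product, Finset.mem_range] at *
    omega
  · intro c hc
    rw [Finset.mem_singleton] at hc
    subst hc
    have := ho (Nat.zero_le r)
    simp [displacedInner]
    omega
  · intro c hc d hd hlt
    rw [Finset.mem_singleton] at hc
    subst hc
    obtain ⟨k, l⟩ := d
    simp only [displacedInner, Finset.mem_filter, Finset.mem_product, Finset.mem_range] at hd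
    rw [Prod.mk_lt_mk] at hlt
    by_cases hk : k = b + r
    · subst hk
      rw [Nat.add_sub_cancel_left] at hd
      omega
    · have := hr' (k - b) (by omega)
      omega

lemma nextVal_displaced (hX : Increasing X) (hL : LowerShape X) {r e : ℕ} (hr : o r = e + 1)
    (hr' : o (r + 1) = 0) (m : ℕ) :
    nextVal (displaced b o X) (b + r) (e + m) = X (r, m) ∧
      (displaced b o X (b + r + 1, e + m) = none ∨
        displaced b o X (b + r + 1, e + m) ≠ X (r, m)) := by
  have h1 : displaced b o X (b + r, e + m + 1) = X (r, m) := by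
    rw [← displaced_add (b := b) (o := o) (X := X), hr]
    congr 2
    omega
  have h2 : displaced b o X (b + r + 1, e + m) = X (r + 1, e + m) := by
    rw [← displaced_add (b := b) (o := o) (X := X), hr']
    congr 2
    omega
  have hlt : (r, m) < (r + 1, e + m) := Prod.mk_lt_mk.2 (.inl ⟨by omega, by omega⟩)
  rcases hv : X (r, m) with _ | v
  · have h3 : X (r + 1, e + m) = none := by
      by_contra h
      exact hL _ _ hlt.le h hv
    exact ⟨nextVal_eq_none.2 ⟨h1.trans hv, h2.trans h3⟩, .inl (h2.trans h3)⟩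
  · have h3 : ∀ w, X (r + 1, e + m) = some w → v < w := fun w hw => hX _ _ hlt v w hv hw
    refine ⟨nextVal_eq_some.2 ⟨.inl (h1.trans hv), fun w hw => ?_, fun w hw => ?_⟩, .inr ?_⟩
    · rw [h1, hv] at hw; cases hw; rfl
    · exact (h3 w (h2.symm.trans hw)).le
    · intro h
      exact lt_irrefl _ (h3 v (h2.symm.trans h))

lemma affected_displaced (hX : Increasing X) (hL : LowerShape X) {r e : ℕ} (hr : o r = e + 1)
    (hr' : o (r + 1) = 0) {i j : ℕ} :
    Affected (displaced b o X) {(b + r, e)} i j ↔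
      ∃ m, i = b + r ∧ j = e + m ∧ ∀ k < m, X (r, k) ≠ none := by
  constructor
  · intro h
    induction h with
    | dot h =>
      rw [Finset.mem_singleton] at h
      cases h
      exact ⟨0, rfl, rfl, by simp⟩
    | right h hv hn ih =>
      obtain ⟨m, rfl, rfl, hm⟩ := ih
      refine ⟨m + 1, rfl, rfl, fun k hk => ?_⟩
      rcases Nat.lt_succ_iff_lt_or_eq.1 hk with h' | rfl
      · exact hm k h'
      · rw [(nextVal_displaced hX hL hr hr' k).1] at hn
        rw [hn]; simp
    | down h hv hn ih =>
      obtain ⟨m, rfl, rfl, hm⟩ := ih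
      obtain ⟨h1, h2⟩ := nextVal_displaced (b := b) hX hL hr hr' m
      rw [h1] at hn
      rw [hn, hv] at h2
      simp at h2
  · rintro ⟨m, rfl, rfl, hm⟩
    induction m with
    | zero => exact .dot (by simp)
    | succ m ih =>
      obtain ⟨v, hv⟩ := Option.ne_none_iff_exists'.1 (hm m (by omega))
      rw [← add_assoc]
      refine .right (v := v) (ih fun k hk => hm k (by omega)) ?_ ?_
      · rw [← hv, ← displaced_add (b := b) (o := o) (X := X), hr]
        congr 2
        omega
      · rw [(nextVal_displaced hX hL hr hr' m).1, hv]

lemma slide_displaced (hX : Increasing X) (hL : LowerShape X) {r e : ℕ} (hr : o r = e + 1)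
    (hr' : o (r + 1) = 0) :
    slide (displaced b o X) {(b + r, e)} = displaced b (Function.update o r e) X := by
  funext ⟨i, j⟩
  have haff := affected_displaced (b := b) hX hL hr hr' (i := i) (j := j)
  by_cases ha : Affected (displaced b o X) {(b + r, e)} i j
  · rw [slide_of_affected ha]
    obtain ⟨m, rfl, rfl, hm⟩ := haff.1 ha
    rw [(nextVal_displaced hX hL hr hr' m).1,
      ← displaced_add (b := b) (o := Function.update o r e) (X := X)]
    simp
  · rw [slide_of_not_affected ha]
    by_cases hi : i = b + r
    · subst hi
      by_cases hj : e ≤ j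
      · obtain ⟨m, rfl⟩ := Nat.exists_eq_add_of_le hj
        have hm : ∃ k < m, X (r, k) = none := by
          by_contra h
          push Not at h
          exact ha (haff.2 ⟨m, rfl, rfl, h⟩)
        obtain ⟨k, hk, hk'⟩ := hm
        have hnone : ∀ l, k ≤ l → X (r, l) = none := fun l hl => by
          by_contra h
          exact hL (r, k) (r, l) (Prod.mk_le_mk.2 ⟨le_rfl, hl⟩) h hk'
        simp only [displaced, Nat.add_sub_cancel_left, hr, Function.update_self]
        rw [if_pos (by omega), if_pos (by omega), hnone _ (by omega), hnone _ (by omega)]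
      · simp only [displaced, Nat.add_sub_cancel_left, hr, Function.update_self]
        rw [if_neg (by omega), if_neg (by omega)]
    · by_cases hb : b ≤ i
      · simp only [displaced, Function.update_of_ne (show i - b ≠ r by omega)]
      · simp only [displaced, hb, false_and, if_false]

/-- Slides move all rows of a displaced tableau to the left. -/
theorem slides_displaced (hX : Increasing X) (hL : LowerShape X) (hb : BoundedBy X H W)
    (ho : Antitone o) (hH : ∀ i, H ≤ i → o i = 0) :
    Relation.ReflTransGen IsForwardSlide (displaced b o X) (displaced b (fun _ => 0) X) := by
  generalize hn : ∑ i ∈ Finset.range H, o i = n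
  induction n using Nat.strong_induction_on generalizing o with
  | _ n ih =>
  by_cases h0 : o 0 = 0
  · have : o = fun _ => 0 := funext fun i => Nat.le_zero.1 (h0 ▸ ho (Nat.zero_le i))
    rw [this]
  have hex : ∃ i, o i = 0 := ⟨H, hH H le_rfl⟩
  obtain ⟨r, hr⟩ := Nat.exists_eq_succ_of_ne_zero
    (show Nat.find hex ≠ 0 from fun h => by
      have := Nat.find_spec hex
      rw [h] at this
      exact h0 this)
  have hr0 : o r ≠ 0 := Nat.find_min hex (by omega)
  obtain ⟨e, he⟩ := Nat.exists_eq_succ_of_ne_zero hr0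
  have hlast : ∀ i, r < i → o i = 0 := fun i hi =>
    Nat.le_zero.1 ((ho (show Nat.find hex ≤ i by omega)).trans (Nat.find_spec hex).le)
  have hrH : r < H := by
    by_contra h
    exact hr0 (hH r (by omega))
  obtain ⟨nu, hs⟩ := displaced_site (b := b) hL hb ho hH he hlast
  have hstep := hs.isForwardSlide (hX.displaced ho)
  rw [slide_displaced hX hL he (hlast _ (by omega))] at hstep
  refine .head hstep (ih _ ?_ ?_ ?_ rfl)
  · rw [← hn]
    refine Finset.sum_lt_sum (fun i _ => ?_) ⟨r, Finset.mem_range.2 hrH, ?_⟩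
    · by_cases h : i = r
      · subst h; simp; omega
      · simp [h]
    · simp; omega
  · intro i j hij
    by_cases hj : j = r
    · subst hj
      by_cases hi : i = j
      · subst hi; rfl
      · have := ho hij
        simp [hi]
        omega
    · by_cases hi : i = r
      · subst hi
        rw [Function.update_of_ne hj, hlast j (by omega)]
        exact Nat.zero_le _
      · rw [Function.update_of_ne hj, Function.update_of_ne hi]
        exact ho hij
  · intro i hi
    rw [Function.update_of_ne (by omega)]
    exact hH i hi

/-- The tableau `X` moved down by `b` rows and right by `c` columns rectifies to `X`. -/
theorem slides_of_shift (hX : Increasing X) (hL : LowerShape X) (hb : BoundedBy X H W)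
    {c : ℕ} {Y : ℕ × ℕ → Option ℤ} (hY : ∀ i j, Y (b + i, c + j) = X (i, j))
    (hY' : ∀ p, ¬ (b ≤ p.1 ∧ c ≤ p.2) → Y p = none) :
    Relation.ReflTransGen IsForwardSlide Y X := by
  have hanti : ∀ m k : ℕ, Antitone fun i => if i < m then k else 0 := by
    intro m k i j hij
    dsimp only
    split_ifs <;> omega
  have h1 := slides_displaced (b := b) hX hL hb (hanti H c) (by intro i hi; simp; omega)
  have h2 := slides_transposed (slides_displaced (b := 0) hX.transposed hL.transposed
    hb.transposed (hanti W b) (by intro i hi; simp; omega))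
  have e1 : displaced b (fun i => if i < H then c else 0) X = Y := by
    funext ⟨k, l⟩
    by_cases h : b ≤ k ∧ c ≤ l
    · obtain ⟨i, rfl⟩ := Nat.exists_eq_add_of_le h.1
      obtain ⟨j, rfl⟩ := Nat.exists_eq_add_of_le h.2
      rw [hY]
      simp only [displaced, Nat.add_sub_cancel_left]
      by_cases hi : i < H
      · simp [hi]
      · have : ∀ j, X (i, j) = none := fun j => by
          by_contra h'
          exact hi (hb _ h').1
        simp [this]
    · rw [hY' _ h]
      by_contra hne
      obtain ⟨i, j, hij⟩ := exists_of_displaced_ne_none hne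
      obtain ⟨rfl, rfl⟩ := Prod.mk.inj hij
      rw [displaced_add (o := fun i => if i < H then c else 0)] at hne
      have := (hb _ hne).1
      simp only at this
      simp [this] at h
  have e2 : transposed (displaced 0 (fun i => if i < W then b else 0) (transposed X)) =
      displaced b (fun _ => 0) X := by
    funext ⟨k, l⟩
    simp only [transposed, displaced, Prod.swap_prod_mk, Nat.zero_le, true_and, Nat.sub_zero,
      and_true]
    by_cases hl : l < W
    · simp [hl]
    · have : ∀ k, X (k, l) = none := fun k => by
        by_contra h'
        exact hl (hb _ h').2
      simp [hl, this]
  have e3 : transposed (displaced 0 (fun _ => 0) (transposed X)) = X := by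
    funext ⟨k, l⟩
    simp [transposed, displaced]
  rw [e1] at h1
  rw [e2, e3] at h2
  exact h1.trans h2

end Displaced

lemma minTab_of_mem {θ : Finset (ℕ × ℕ)} (hθ : StraightShape θ) {i j : ℕ} (h : (i, j) ∈ θ) :
    minTab θ (i, j) = some (i + j + 1 : ℤ) := by
  have hgreatest : IsGreatest {n : ℕ | ∃ s : Finset (ℕ × ℕ), (s : Set (ℕ × ℕ)) ⊆ (θ : Set (ℕ × ℕ)) ∧
      (∀ a ∈ s, ∀ b ∈ s, a ≤ b ∨ b ≤ a) ∧ (i, j) ∈ s ∧ (∀ a ∈ s, a ≤ (i, j)) ∧ s.card = n}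
      (i + j + 1) := by
    constructor
    · refine ⟨(Finset.range (i + j + 1)).image fun m => (min m i, m - i), ?_, ?_, ?_, ?_, ?_⟩
      · intro p hp
        obtain ⟨m, hm, rfl⟩ := Finset.mem_image.1 hp
        rw [Finset.mem_range] at hm
        exact hθ _ h _ (Prod.mk_le_mk.2 (by omega))
      · intro p hp q hq
        obtain ⟨m, hm, rfl⟩ := Finset.mem_image.1 hp
        obtain ⟨n, hn, rfl⟩ := Finset.mem_image.1 hq
        simp only [Prod.mk_le_mk]
        omega
      · refine Finset.mem_image.2 ⟨i + j, by simp, ?_⟩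
        simp
      · intro p hp
        obtain ⟨m, hm, rfl⟩ := Finset.mem_image.1 hp
        rw [Finset.mem_range] at hm
        exact Prod.mk_le_mk.2 (by omega)
      · rw [Finset.card_image_of_injective, Finset.card_range]
        intro m n hmn
        have := Prod.mk.inj hmn
        omega
    · rintro n ⟨s, -, hchain, -, hle, rfl⟩
      rw [← Finset.card_range (i + j + 1)]
      refine Finset.card_le_card_of_injOn (fun p => p.1 + p.2) (fun p hp => ?_) ?_
      · have := hle p hp
        rw [Prod.le_def] at this
        simp only [Finset.coe_range, Set.mem_Iio] at this ⊢
        omega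
      · intro p hp q hq hpq
        have := hchain p hp q hq
        simp only [Prod.le_def] at this hpq
        ext <;> omega
  unfold minTab
  rw [if_pos h, hgreatest.csSup_eq]
  push_cast
  rfl

lemma straightShape_fatHook {a b c d : ℕ} : StraightShape (fatHook a b c d) := by
  rintro ⟨i, j⟩ hp ⟨k, l⟩ hq
  simp only [fatHook, Finset.mem_filter, Finset.mem_product, Finset.mem_range,
    Prod.mk_le_mk] at hp hq ⊢
  omega

lemma mem_fatHook {a b c d i j : ℕ} :
    (i, j) ∈ fatHook a b c d ↔ (i < b + d ∧ j < a) ∧ (i < b ∨ j < c) := by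
  simp [fatHook]

section Glue

variable {a b c d : ℕ} {U : ℕ × ℕ → Option ℤ}

lemma fatHookGlue_add (i j : ℕ) : fatHookGlue a b c d U (b + i, c + j) = U (i, j) := by
  simp [fatHookGlue]

lemma fatHookGlue_of_mem {i j : ℕ} (h : (i, j) ∈ fatHook a b c d) :
    fatHookGlue a b c d U (i, j) = some (i + j + 1 : ℤ) := by
  have := mem_fatHook.1 h
  simp only [fatHookGlue]
  rw [if_neg (by omega), minTab_of_mem straightShape_fatHook h]

lemma fatHookGlue_ne_none {p : ℕ × ℕ} : fatHookGlue a b c d U p ≠ none ↔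
    p ∈ fatHook a b c d ∨ ∃ i j, p = (b + i, c + j) ∧ U (i, j) ≠ none := by
  obtain ⟨k, l⟩ := p
  constructor
  · intro h
    by_cases hp : b ≤ k ∧ c ≤ l
    · obtain ⟨i, rfl⟩ := Nat.exists_eq_add_of_le hp.1
      obtain ⟨j, rfl⟩ := Nat.exists_eq_add_of_le hp.2
      rw [fatHookGlue_add] at h
      exact .inr ⟨i, j, rfl, h⟩
    · left
      by_contra hn
      simp [fatHookGlue, minTab, hp, hn] at h
  · rintro (h | ⟨i, j, hp, h⟩)
    · rw [fatHookGlue_of_mem h]; simp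
    · rw [hp, fatHookGlue_add]; exact h

lemma hasStraightShape_fatHookGlue (hca : c ≤ a) (hU : HasStraightShape U)
    (hfit : ∀ q : ℕ × ℕ, U q ≠ none → q.1 < d ∧ q.2 < a - c) :
    HasStraightShape (fatHookGlue a b c d U) := by
  have hL := hU.lowerShape
  obtain ⟨mu, hmu, hUmu⟩ := hU
  have hmem : ∀ p, U p ≠ none ↔ p ∈ mu := fun p => by
    simpa [shapeOf] using Set.ext_iff.1 hUmu p
  refine ⟨fatHook a b c d ∪ mu.image fun q => (b + q.1, c + q.2), ?_, ?_⟩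
  · intro p hp q hqp
    rw [Finset.mem_union] at hp ⊢
    rcases hp with hp | hp
    · exact .inl (straightShape_fatHook p hp q hqp)
    · obtain ⟨⟨i, j⟩, hr, rfl⟩ := Finset.mem_image.1 hp
      obtain ⟨k, l⟩ := q
      rw [Prod.mk_le_mk] at hqp
      have hf := hfit _ ((hmem _).2 hr)
      simp only at hqp hf
      by_cases hq : b ≤ k ∧ c ≤ l
      · obtain ⟨k, rfl⟩ := Nat.exists_eq_add_of_le hq.1
        obtain ⟨l, rfl⟩ := Nat.exists_eq_add_of_le hq.2
        exact .inr (Finset.mem_image.2 ⟨(k, l), hmu _ hr _ (Prod.mk_le_mk.2 (by omega)), rfl⟩)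
      · exact .inl (mem_fatHook.2 (by omega))
  · ext p
    change fatHookGlue a b c d U p ≠ none ↔ _
    rw [fatHookGlue_ne_none, Finset.mem_coe, Finset.mem_union, Finset.mem_image]
    simp only [hmem, Prod.exists]
    grind

lemma increasing_fatHookGlue (hU : Increasing U)
    (hbig : ∀ (q q' : ℕ × ℕ) (x y : ℤ),
      minTab (fatHook a b c d) q = some x → U q' = some y → x < y) :
    Increasing (fatHookGlue a b c d U) := by
  intro p q hpq x y hx hy
  rcases fatHookGlue_ne_none.1 (by rw [hx]; simp : fatHookGlue a b c d U p ≠ none) with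
    hp | ⟨i, j, rfl, hp⟩
  · obtain ⟨i, j⟩ := p
    have hx' := minTab_of_mem straightShape_fatHook hp
    rw [fatHookGlue_of_mem hp] at hx
    rcases fatHookGlue_ne_none.1 (by rw [hy]; simp : fatHookGlue a b c d U q ≠ none) with
      hq | ⟨k, l, rfl, hq⟩
    · obtain ⟨k, l⟩ := q
      rw [fatHookGlue_of_mem hq] at hy
      cases hx
      cases hy
      rw [Prod.mk_lt_mk] at hpq
      omega
    · rw [fatHookGlue_add] at hy
      exact hbig _ _ x y (hx'.trans hx) hy
  · rw [fatHookGlue_add] at hx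
    obtain ⟨k, l⟩ := q
    rw [Prod.mk_lt_mk] at hpq
    obtain ⟨k, rfl⟩ := Nat.exists_eq_add_of_le (show b ≤ k by omega)
    obtain ⟨l, rfl⟩ := Nat.exists_eq_add_of_le (show c ≤ l by omega)
    rw [fatHookGlue_add] at hy
    exact hU _ _ (Prod.mk_lt_mk.2 (by omega)) x y hx hy

lemma exists_threshold (hU : HasStraightShape U) (hi : Increasing U)
    (hbig : ∀ (q q' : ℕ × ℕ) (x y : ℤ),
      minTab (fatHook a b c d) q = some x → U q' = some y → x < y) :
    ∃ N : ℤ, (∀ i j, (i, j) ∈ fatHook a b c d → (i + j + 1 : ℤ) ≤ N) ∧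
      ∀ q x, U q = some x → N < x := by
  rcases h0 : U (0, 0) with _ | u
  · refine ⟨a + b + d, fun i j h => ?_, fun q x hx => ?_⟩
    · have := mem_fatHook.1 h
      omega
    · exact absurd h0 (hU.lowerShape (0, 0) q (Prod.mk_le_mk.2 ⟨Nat.zero_le _, Nat.zero_le _⟩)
        (by rw [hx]; simp))
  · refine ⟨u - 1, fun i j h => ?_, fun q x hx => ?_⟩
    · have := hbig _ _ _ _ (minTab_of_mem straightShape_fatHook h) h0
      omega
    · rcases (show ((0, 0) : ℕ × ℕ) ≤ q from Prod.mk_le_mk.2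
        ⟨Nat.zero_le _, Nat.zero_le _⟩).eq_or_lt with rfl | hlt
      · rw [h0] at hx; cases hx; omega
      · have := hi _ _ hlt _ _ h0 hx
        omega

lemma fatHookGlue_eq_none (hca : c ≤ a)
    (hfit : ∀ q : ℕ × ℕ, U q ≠ none → q.1 < d ∧ q.2 < a - c) {i j : ℕ}
    (h : b + d ≤ i ∨ a ≤ j) : fatHookGlue a b c d U (i, j) = none := by
  by_contra hne
  rcases fatHookGlue_ne_none.1 hne with h' | ⟨k, l, hp, h'⟩
  · have := mem_fatHook.1 h'
    omega
  · have := hfit _ h'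
    have := Prod.mk.inj hp
    simp only at *
    omega

/-- A straight tableau with the same words, up to equivalence, as a glued tableau contains the
minimal tableau of the fat hook. -/
lemma hookTab_of_wordEquiv (hca : c ≤ a)
    (hfit : ∀ q : ℕ × ℕ, U q ≠ none → q.1 < d ∧ q.2 < a - c)
    {V' : ℕ × ℕ → Option ℤ} (h : WordEquiv (fatHookGlue a b c d U) V')
    (ht : WordEquiv (transposed (fatHookGlue a b c d U)) (transposed V'))
    (hV : LowerShape (fatHookGlue a b c d U)) (hi : Increasing (fatHookGlue a b c d U))
    (hV' : LowerShape V') (hi' : Increasing V') : HookTab a b c d V' where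
  upper := h.block hV hi hV' hi'
    (fun i hib j hja => fatHookGlue_of_mem (mem_fatHook.2 (by omega)))
    (fun k hk => fatHookGlue_eq_none hca hfit (.inr hk))
  upper_none i _ j hj := by
    have h0 : V' (0, j) = none :=
      (h.first_row hV hi hV' hi' j).trans (fatHookGlue_eq_none hca hfit (.inr hj))
    by_contra hne
    exact hV' (0, j) (i, j) (Prod.mk_le_mk.2 ⟨Nat.zero_le _, le_rfl⟩) hne h0
  lower i _ hi2 j hj := by
    have key := ht.block (a := b + d) (b := c) hV.transposed hi.transposed hV'.transposed
      hi'.transposed (fun j hj i hi => by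
        have := fatHookGlue_of_mem (U := U) (mem_fatHook.2 (show (i < b + d ∧ j < a) ∧
          (i < b ∨ j < c) by omega))
        simp only [transposed, Prod.swap_prod_mk, this]
        congr 1
        ring)
      (fun k hk => fatHookGlue_eq_none hca hfit (.inl hk)) j hj i hi2
    simp only [transposed, Prod.swap_prod_mk] at key
    rw [key]
    congr 1
    ring
  lower_none i j hij := by
    have h0 : V' (i, 0) = none :=
      (ht.first_row hV.transposed hi.transposed hV'.transposed hi'.transposed i).trans
        (fatHookGlue_eq_none hca hfit (.inl hij))
    by_contra hne
    exact hV' (i, 0) (i, j) (Prod.mk_le_mk.2 ⟨le_rfl, Nat.zero_le _⟩) hne h0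

lemma hookTab_fatHookGlue (hca : c ≤ a)
    (hfit : ∀ q : ℕ × ℕ, U q ≠ none → q.1 < d ∧ q.2 < a - c) :
    HookTab a b c d (fatHookGlue a b c d U) where
  upper i _ j _ := fatHookGlue_of_mem (mem_fatHook.2 (by omega))
  upper_none i _ j hj := fatHookGlue_eq_none hca hfit (.inr hj)
  lower i _ _ j _ := fatHookGlue_of_mem (mem_fatHook.2 (by omega))
  lower_none i j hij := fatHookGlue_eq_none hca hfit (.inl hij)

end Glue

/-- The part of `V` in the quadrant with corner `(b, c)`, moved to the origin. -/
def quadrant (b c : ℕ) (V : ℕ × ℕ → Option ℤ) : ℕ × ℕ → Option ℤ := fun q =>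
  V (b + q.1, c + q.2)

section Quadrant

variable {b c : ℕ} {V : ℕ × ℕ → Option ℤ}

lemma HasStraightShape.quadrant (h : HasStraightShape V) :
    HasStraightShape (quadrant b c V) := by
  have hL := h.lowerShape
  obtain ⟨mu, -, hVmu⟩ := h
  have hmem : ∀ p, V p ≠ none ↔ p ∈ mu := fun p => by
    simpa [shapeOf] using Set.ext_iff.1 hVmu p
  refine ⟨(mu.image fun p => (p.1 - b, p.2 - c)).filter fun q => (b + q.1, c + q.2) ∈ mu, ?_, ?_⟩
  · have himp : ∀ q : ℕ × ℕ, (b + q.1, c + q.2) ∈ mu →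
        q ∈ mu.image fun p => (p.1 - b, p.2 - c) := fun q hq =>
      Finset.mem_image.2 ⟨_, hq, by simp⟩
    intro p hp q hqp
    rw [Finset.mem_filter] at hp ⊢
    have hq : (b + q.1, c + q.2) ∈ mu := by
      rw [← hmem]
      refine hL _ _ ?_ ((hmem _).2 hp.2)
      rw [Prod.le_def] at hqp
      rw [Prod.mk_le_mk]
      omega
    exact ⟨himp q hq, hq⟩
  · ext q
    change V (b + q.1, c + q.2) ≠ none ↔ _
    rw [hmem, Finset.mem_coe, Finset.mem_filter, Finset.mem_image]
    exact ⟨fun hq => ⟨⟨_, hq, by simp⟩, hq⟩, fun hq => hq.2⟩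

lemma Increasing.quadrant (h : Increasing V) : Increasing (quadrant b c V) := by
  intro p q hpq x y hx hy
  refine h _ _ ?_ x y hx hy
  rw [Prod.lt_iff] at hpq ⊢
  simp only
  omega

lemma HasStraightShape.exists_boundedBy (h : HasStraightShape V) : ∃ R K, BoundedBy V R K := by
  obtain ⟨mu, -, hVmu⟩ := h
  exact exists_boundedBy_of_subset (nu := mu) fun p hp => by
    simpa [shapeOf, hp] using Set.ext_iff.1 hVmu p

/-- If exactly the entries in the quadrant with corner `(b, c)` exceed `N`, then the part of `V`
above `N` rectifies to the contents of the quadrant. -/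
lemma slides_above_quadrant (hV : HasStraightShape V) (hi : Increasing V) {N : ℤ}
    (h1 : ∀ q x, quadrant b c V q = some x → N < x)
    (h2 : ∀ p x, ¬ (b ≤ p.1 ∧ c ≤ p.2) → V p = some x → x ≤ N) :
    Relation.ReflTransGen IsForwardSlide (above N V) (quadrant b c V) := by
  obtain ⟨R, K, hb⟩ := hV.quadrant (b := b) (c := c).exists_boundedBy
  refine slides_of_shift hi.quadrant hV.quadrant.lowerShape hb (fun i j => ?_)
    fun p hp => above_eq_none.2 fun v hv => h2 p v hp hv
  change above N V (b + i, c + j) = V (b + i, c + j)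
  rcases hv : V (b + i, c + j) with _ | v
  · exact above_eq_none.2 fun v h' => by rw [hv] at h'; cases h'
  · exact above_eq_some.2 ⟨hv, h1 (i, j) v hv⟩

end Quadrant

lemma HookTab.le_of_not_mem_quadrant {a b c d : ℕ} {V : ℕ × ℕ → Option ℤ}
    (h : HookTab a b c d V) (hca : c ≤ a) {N : ℤ}
    (hN : ∀ i j, (i, j) ∈ fatHook a b c d → (i + j + 1 : ℤ) ≤ N) (p : ℕ × ℕ) (x : ℤ)
    (hp : ¬ (b ≤ p.1 ∧ c ≤ p.2)) (hx : V p = some x) : x ≤ N := by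
  obtain ⟨i, j⟩ := p
  simp only at hp
  by_cases hib : i < b
  · by_cases hj : j < a
    · rw [h.upper i hib j hj] at hx
      cases hx
      exact hN i j (mem_fatHook.2 (by omega))
    · rw [h.upper_none i hib j (by omega)] at hx; cases hx
  · by_cases hid : i < b + d
    · rw [h.lower i (by omega) hid j (by omega)] at hx
      cases hx
      exact hN i j (mem_fatHook.2 (by omega))
    · rw [h.lower_none i j (by omega)] at hx; cases hx

lemma HookTab.ext_of_quadrant {a b c d : ℕ} {V V' : ℕ × ℕ → Option ℤ}
    (h : HookTab a b c d V) (h' : HookTab a b c d V')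
    (hq : quadrant b c V = quadrant b c V') : V = V' := by
  funext ⟨i, j⟩
  by_cases hp : b ≤ i ∧ c ≤ j
  · obtain ⟨i, rfl⟩ := Nat.exists_eq_add_of_le hp.1
    obtain ⟨j, rfl⟩ := Nat.exists_eq_add_of_le hp.2
    exact congrFun hq (i, j)
  by_cases hib : i < b
  · by_cases hj : j < a
    · rw [h.upper i hib j hj, h'.upper i hib j hj]
    · rw [h.upper_none i hib j (by omega), h'.upper_none i hib j (by omega)]
  · by_cases hid : i < b + d
    · rw [h.lower i (by omega) hid j (by omega), h'.lower i (by omega) hid j (by omega)]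
    · rw [h.lower_none i j (by omega), h'.lower_none i j (by omega)]

lemma IncreasingSkewTableau.exists_boundedBy {T : ℕ × ℕ → Option ℤ}
    (h : IncreasingSkewTableau T) : ∃ R K, BoundedBy T R K := by
  obtain ⟨⟨lam, nu, -, hsh⟩, -⟩ := h
  refine exists_boundedBy_of_subset (nu := nu) fun p hp => ?_
  have : p ∈ shapeOf T := hp
  rw [hsh] at this
  exact this.1

theorem fat_hook_glue_urt
    (a b c d : ℕ) (hca : c ≤ a)
    (U : ℕ × ℕ → Option ℤ) (hU : IsURT U)
    (hfit : ∀ q : ℕ × ℕ, U q ≠ none → q.1 < d ∧ q.2 < a - c)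
    (hbig : ∀ (q q' : ℕ × ℕ) (x y : ℤ),
      minTab (fatHook a b c d) q = some x → U q' = some y → x < y) :
    IsURT (fatHookGlue a b c d U) := by
  by_cases hbc : b = 0 ∧ c = 0
  · obtain ⟨rfl, rfl⟩ := hbc
    have : fatHookGlue a 0 0 d U = U := by
      funext p
      simp [fatHookGlue]
    rwa [this]
  have hVs := hasStraightShape_fatHookGlue (b := b) hca hU.1 hfit
  have hVi := increasing_fatHookGlue hU.2.1 hbig
  refine ⟨hVs, hVi, fun T hT hTV V' hTV' => ?_⟩
  obtain ⟨R, K, hb⟩ := hT.exists_boundedBy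
  have hV'i := (slides_increasing hT.2 hb hTV'.1).1
  have hVL := hVs.lowerShape
  have hV'L := hTV'.2.lowerShape
  have he := wordEquiv_of_slides hT.2 hb hTV.1 hTV'.1
  have het := wordEquiv_of_slides hT.2.transposed hb.transposed (slides_transposed hTV.1)
    (slides_transposed hTV'.1)
  have hH' := hookTab_of_wordEquiv hca hfit he het hVL hVi hV'L hV'i
  have hH := hookTab_fatHookGlue (b := b) hca hfit
  obtain ⟨N, hN, hUN⟩ := exists_threshold hU.1 hU.2.1 hbig
  have hquad : quadrant b c (fatHookGlue a b c d U) = U := funext fun q => fatHookGlue_add q.1 q.2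
  have hcorner : ∀ v, V' (b, c) = some v → N < v := by
    intro v hv
    by_contra hvN
    have hd : 0 < d := by
      by_contra hd
      rw [hH'.lower_none b c (by omega)] at hv
      cases hv
    have h00' : V' (0, 0) ≠ none :=
      hV'L _ (b, c) (Prod.mk_le_mk.2 ⟨Nat.zero_le _, Nat.zero_le _⟩) (by rw [hv]; simp)
    have h00 : V' (0, 0) = some 1 := by
      rw [he.first_row hVL hVi hV'L hV'i] at h00' ⊢
      rcases fatHookGlue_ne_none.1 h00' with h | ⟨i, j, hp, -⟩
      · exact fatHookGlue_of_mem h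
      · have := Prod.mk.inj hp
        omega
    refine he.corner_ne hH hH' hd (hV'L.le_apply hV'i h00 hv) (fun i j x hbi hcj hx => ?_)
      (fun i j x hbi hcj hx => ?_) hv
    · obtain ⟨i, rfl⟩ := Nat.exists_eq_add_of_le hbi
      obtain ⟨j, rfl⟩ := Nat.exists_eq_add_of_le hcj
      rw [fatHookGlue_add] at hx
      have := hUN _ _ hx
      omega
    · rcases (show (b, c) ≤ (i, j) from Prod.mk_le_mk.2 ⟨hbi, hcj⟩).eq_or_lt with h | h
      · obtain ⟨rfl, rfl⟩ := Prod.mk.inj h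
        rw [hv] at hx
        cases hx
        exact .inr ⟨rfl, rfl, rfl⟩
      · exact .inl (hV'i _ _ h _ _ hv hx)
  have hlarge : ∀ q x, quadrant b c V' q = some x → N < x := by
    intro q x hx
    have hle : (b, c) ≤ (b + q.1, c + q.2) := Prod.mk_le_mk.2 ⟨by omega, by omega⟩
    obtain ⟨v, hv⟩ := Option.ne_none_iff_exists'.1
      (hV'L _ _ hle (show V' (b + q.1, c + q.2) ≠ none by rw [show V' _ = _ from hx]; simp))
    rcases hle.eq_or_lt with h | h
    · exact hcorner x (by rw [h]; exact hx)
    · exact (hcorner v hv).trans (hV'i _ _ h _ _ hv hx)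
  have hrect := (slides_above hTV.1 hT.2 N).trans (slides_above_quadrant (b := b) (c := c) hVs hVi
    (by rwa [hquad]) (hH.le_of_not_mem_quadrant hca hN))
  have hrect' := (slides_above hTV'.1 hT.2 N).trans (slides_above_quadrant (b := b) (c := c)
    hTV'.2 hV'i hlarge (hH'.le_of_not_mem_quadrant hca hN))
  rw [hquad] at hrect
  have hfinal := hU.2.2 (above N T) ⟨HasSkewShape.above hT N, hT.2.above N⟩ ⟨hrect, hU.1⟩ _
    ⟨hrect', hTV'.2.quadrant⟩
  exact (hH.ext_of_quadrant hH' (hquad.trans hfinal.symm)).symm
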